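/- arXiv:0907.1598 — 2 statements merged into one kernel-verified Lean document; each statement's English description precedes it below -/
import Mathlib

section
/- Rearrangement inequality for compound Poisson processes: Let φ : ℝ^d → [0,∞) be a probability density (measurable with ∫_{ℝ^d} φ = 1) vanishing at infinity, let f₁,…,f_m : ℝ^d → [0,∞) be continuous functions vanishing at infinity, let c > 0, and let 0 = t₀ ≤ t₁ ≤ ⋯ ≤ t_m be real numbers. For integers 0 = k₀ ≤ k₁ ≤ ⋯ ≤ k_m and x₀ ∈ ℝ^d define I_{x₀}(k₁,…,k_m) = ∫_{(ℝ^d)^{k_m}} ∏_{i=1}^m f_i(x₀ + x₁ + ⋯ + x_{k_i}) ∏_{j=1}^{k_m} φ(x_j) dx₁⋯dx_{k_m} and I*(k₁,…,k_m) = ∫_{(ℝ^d)^{k_m}} ∏_{i=1}^m f_i*(x₁ + ⋯ + x_{k_i}) ∏_{j=1}^{k_m} φ*(x_j) dx₁⋯dx_{k_m} (with an empty sum of the x_j's understood to be 0, an empty integral equal to the value of the integrand at the empty configuration, and all integrals in [0,∞]). Then for every x₀ ∈ ℝ^d, ∑_{0 ≤ k₁ ≤ ⋯ ≤ k_m} [∏_{i=1}^m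 e^{-c(t_i - t_{i-1})} (c(t_i - t_{i-1}))^{k_i - k_{i-1}} / (k_i - k_{i-1})!] · I_{x₀}(k₁,…,k_m) ≤ ∑_{0 ≤ k₁ ≤ ⋯ ≤ k_m} [∏_{i=1}^m e^{-c(t_i - t_{i-1})} (c(t_i - t_{i-1}))^{k_i - k_{i-1}} / (k_i - k_{i-1})!] · I*(k₁,…,k_m), where by convention 0⁰ = 1. -/
open MeasureTheory ENNReal Filter Topology
open scoped RealInnerProductSpace

/-- A nonnegative function on `ℝ^d` vanishes at infinity if all its positive
super-level sets have finite Lebesgue measure. -/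
def VanishesAtInfinity {d : ℕ} (f : EuclideanSpace ℝ (Fin d) → ℝ) : Prop :=
  ∀ t : ℝ, 0 < t → volume {x : EuclideanSpace ℝ (Fin d) | t < f x} < ⊤

/-- Radius of the ball centered at the origin having the same volume as `A`. -/
noncomputable def symmRadius {d : ℕ} (A : Set (EuclideanSpace ℝ (Fin d))) : ℝ :=
  ((volume A / volume (Metric.ball (0 : EuclideanSpace ℝ (Fin d)) 1)).toReal) ^ ((1 : ℝ) / d)

/-- `A*`: the open ball centered at the origin with the same Lebesgue measure as `A`. -/
noncomputable def ballStar {d : ℕ} (A : Set (EuclideanSpace ℝ (Fin d))) :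
    Set (EuclideanSpace ℝ (Fin d)) :=
  Metric.ball 0 (symmRadius A)

/-- Symmetric decreasing rearrangement `f*` (with values in `[0,∞]`):
`f*(x) = ∫₀^∞ 1_{{f>t}*}(x) dt`. -/
noncomputable def symmRearrange {d : ℕ} (f : EuclideanSpace ℝ (Fin d) → ℝ)
    (x : EuclideanSpace ℝ (Fin d)) : ℝ≥0∞ :=
  ∫⁻ t in Set.Ioi (0 : ℝ), (ballStar {y | t < f y}).indicator (fun _ => (1 : ℝ≥0∞)) x

/-- `x₁ + ⋯ + x_n` for a configuration `x` (indices shifted by one: `x j` is `x_{j+1}`);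
an empty sum is `0`. -/
noncomputable def partialSum {d K : ℕ} (x : Fin K → EuclideanSpace ℝ (Fin d)) (n : ℕ) :
    EuclideanSpace ℝ (Fin d) :=
  ∑ j : Fin K, if (j : ℕ) < n then x j else 0


/-- The multiple integral `I_{x₀}(k₁,…,k_m)` over `(ℝ^d)^{k_m}` (here `k_m` is realized as
`Finset.univ.sup k`, which equals `k_m` for monotone `k`); for `k_m = 0` this is the value of
the integrand at the empty configuration. -/
noncomputable def walkIntegral {d m : ℕ} (f : Fin m → EuclideanSpace ℝ (Fin d) → ℝ)
    (φ : EuclideanSpace ℝ (Fin d) → ℝ) (x₀ : EuclideanSpace ℝ (Fin d)) (k : Fin m → ℕ) :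
    ℝ≥0∞ :=
  ∫⁻ x : Fin (Finset.univ.sup k) → EuclideanSpace ℝ (Fin d),
    (∏ i, ENNReal.ofReal (f i (x₀ + partialSum x (k i)))) *
      ∏ j, ENNReal.ofReal (φ (x j))

/-- The symmetrized multiple integral `I*(k₁,…,k_m)`. -/
noncomputable def walkIntegralStar {d m : ℕ} (f : Fin m → EuclideanSpace ℝ (Fin d) → ℝ)
    (φ : EuclideanSpace ℝ (Fin d) → ℝ) (k : Fin m → ℕ) : ℝ≥0∞ :=
  ∫⁻ x : Fin (Finset.univ.sup k) → EuclideanSpace ℝ (Fin d),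
    (∏ i, symmRearrange (f i) (partialSum x (k i))) *
      ∏ j, symmRearrange φ (x j)

/-- The joint probability `P[N_{t₁}=k₁,…,N_{t_m}=k_m]` for a Poisson process of intensity `c`,
written in terms of the increments `j i = k_{i+1} - k_i`:
`∏_{i=1}^m e^{-c(t_i-t_{i-1})} (c(t_i-t_{i-1}))^{j_i} / j_i!` (with `0⁰ = 1`). -/
noncomputable def poissonWeight (c : ℝ) (t : ℕ → ℝ) (m : ℕ) (j : Fin m → ℕ) : ℝ≥0∞ :=
  ∏ i : Fin m, ENNReal.ofReal
    (Real.exp (-(c * (t ((i : ℕ) + 1) - t (i : ℕ)))) *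
      (c * (t ((i : ℕ) + 1) - t (i : ℕ))) ^ (j i) / (Nat.factorial (j i)))

/-- The pairs `(x, y)` with `x ∈ A`, `y ∈ B` and `x + y ∈ C`. -/
def sumTriples {G : Type*} [Add G] (A B C : Set G) : Set (G × G) :=
  {p | p.1 ∈ A ∧ p.2 ∈ B ∧ p.1 + p.2 ∈ C}

/-- The Riesz functional `∫∫ 1_A(x) 1_B(y) 1_C(x + y) dx dy`. -/
noncomputable def rieszForm {G : Type*} [MeasureSpace G] [Add G] (A B C : Set G) : ℝ≥0∞ :=
  ((volume : Measure G).prod volume) (sumTriples A B C)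

section General

theorem sumTriples_mono {G : Type*} [Add G] {A B C A' B' C' : Set G} (hA : A ⊆ A')
    (hB : B ⊆ B') (hC : C ⊆ C') : sumTriples A B C ⊆ sumTriples A' B' C' :=
  fun _ h => ⟨hA h.1, hB h.2.1, hC h.2.2⟩

variable {G : Type*} [MeasureSpace G] [AddCommGroup G]

theorem rieszForm_mono {A B C A' B' C' : Set G} (hA : A ⊆ A') (hB : B ⊆ B') (hC : C ⊆ C') :
    rieszForm A B C ≤ rieszForm A' B' C' :=
  measure_mono (sumTriples_mono hA hB hC)

theorem measurableSet_sumTriples [MeasurableAdd₂ G] {A B C : Set G} (hA : MeasurableSet A)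
    (hB : MeasurableSet B) (hC : MeasurableSet C) : MeasurableSet (sumTriples A B C) :=
  (measurable_fst hA).inter ((measurable_snd hB).inter (measurable_add hC))

theorem rieszForm_le_mul_left [SFinite (volume : Measure G)] (A B C : Set G) :
    rieszForm A B C ≤ volume A * volume B := by
  rw [← Measure.prod_prod]
  exact measure_mono fun p hp => ⟨hp.1, hp.2.1⟩

theorem rieszForm_comm [SFinite (volume : Measure G)] [MeasurableAdd₂ G] {A B C : Set G}
    (hA : MeasurableSet A) (hB : MeasurableSet B) (hC : MeasurableSet C) :
    rieszForm A B C = rieszForm B A C := by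
  have h := (Measure.measurePreserving_swap (μ := (volume : Measure G))
    (ν := (volume : Measure G))).measure_preimage
    (measurableSet_sumTriples hB hA hC).nullMeasurableSet
  rw [rieszForm, rieszForm, ← h]
  congr 1
  ext p
  simp only [sumTriples, Set.mem_ofPred_eq, Set.mem_preimage, Prod.fst_swap, Prod.snd_swap,
    add_comm p.2 p.1]
  tauto

theorem rieszForm_le_mul_right [SFinite (volume : Measure G)] [MeasurableAdd₂ G]
    [(volume : Measure G).IsAddLeftInvariant] (A B C : Set G)
    (hA : MeasurableSet A) (hC : MeasurableSet C) :
    rieszForm A B C ≤ volume A * volume C := by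
  rw [← Measure.prod_prod, ← (measurePreserving_prod_add (volume : Measure G)
    (volume : Measure G)).measure_preimage (hA.prod hC).nullMeasurableSet]
  exact measure_mono fun p hp => ⟨hp.1, hp.2.2⟩

end General

section Line

/-- The symmetric open interval of length `a`. -/
def symmInterval (a : ℝ≥0∞) : Set ℝ := {s | ENNReal.ofReal (2 * |s|) < a}

theorem symmInterval_ofReal {a : ℝ} : 
    symmInterval (ENNReal.ofReal a) = Set.Ioo (-(a / 2)) (a / 2) := by
  ext s
  simp only [symmInterval, Set.mem_ofPred_eq, Set.mem_Ioo, ← abs_lt]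
  by_cases ha : 0 < a
  · rw [ENNReal.ofReal_lt_ofReal_iff ha]
    constructor <;> intro h <;> linarith
  · rw [ENNReal.ofReal_of_nonpos (not_lt.mp ha)]
    have := abs_nonneg s
    simp only [not_lt_zero, false_iff, not_lt]
    linarith

theorem symmInterval_top : symmInterval ⊤ = Set.univ := by
  ext s
  simp only [symmInterval, Set.mem_ofPred_eq, Set.mem_univ, iff_true]
  exact ENNReal.ofReal_lt_top

theorem volume_symmInterval (a : ℝ≥0∞) : volume (symmInterval a) = a := by
  induction a with
  | top => simp [symmInterval_top]
  | coe a =>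
    rw [← ENNReal.ofReal_coe_nnreal, symmInterval_ofReal, Real.volume_Ioo]
    congr 1
    ring

theorem measurableSet_symmInterval (a : ℝ≥0∞) : MeasurableSet (symmInterval a) :=
  measurableSet_lt (by fun_prop) measurable_const

theorem mem_symmInterval_of_abs_le {a : ℝ≥0∞} {s s' : ℝ} (h : s ∈ symmInterval a)
    (hs : |s'| ≤ |s|) : s' ∈ symmInterval a :=
  (ENNReal.ofReal_le_ofReal (by linarith)).trans_lt h

theorem add_mem_symmInterval {a b c : ℝ≥0∞} (h : a + b ≤ c) {x y : ℝ}
    (hx : x ∈ symmInterval a) (hy : y ∈ symmInterval b) : x + y ∈ symmInterval c := by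
  refine lt_of_lt_of_le (lt_of_le_of_lt ?_ (ENNReal.add_lt_add hx hy)) h
  rw [← ENNReal.ofReal_add (by positivity) (by positivity)]
  exact ENNReal.ofReal_le_ofReal (by linarith [abs_add_le x y])

theorem neg_mem_symmInterval {a : ℝ≥0∞} {x : ℝ} (hx : x ∈ symmInterval a) :
    -x ∈ symmInterval a :=
  mem_symmInterval_of_abs_le hx (abs_neg x).le

theorem exists_volume_inter_Iio_eq {A : Set ℝ} (hA : MeasurableSet A) (hA' : volume A ≠ ⊤)
    {t : ℝ} (ht0 : 0 < t) (ht : ENNReal.ofReal t < volume A) :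
    ∃ p, volume (A ∩ Set.Iio p) = ENNReal.ofReal t := by
  have hfin : ∀ S : Set ℝ, volume (A ∩ S) ≠ ⊤ := fun S =>
    ne_top_of_le_ne_top hA' (measure_mono Set.inter_subset_left)
  set F : ℝ → ℝ := fun p => (volume (A ∩ Set.Iio p)).toReal with hF
  have hlip : ∀ p q, p ≤ q → F p ≤ F q ∧ F q ≤ F p + (q - p) := by
    intro p q hpq
    constructor
    · exact ENNReal.toReal_mono (hfin _)
        (measure_mono (Set.inter_subset_inter_right _ (Set.Iio_subset_Iio hpq)))
    · have h : volume (A ∩ Set.Iio q) ≤ volume (A ∩ Set.Iio p) + ENNReal.ofReal (q - p) := by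
        rw [← Real.volume_Ico]
        refine (measure_mono ?_).trans (measure_union_le _ _)
        intro x hx
        by_cases h : x < p
        · exact Or.inl ⟨hx.1, h⟩
        · exact Or.inr ⟨not_lt.mp h, hx.2⟩
      have h' := ENNReal.toReal_mono (by simp [hfin]) h
      rwa [ENNReal.toReal_add (hfin _) (by simp), ENNReal.toReal_ofReal (by linarith)] at h'
  have hcont : Continuous F := by
    refine (LipschitzWith.of_le_add (f := F) fun p q => ?_).continuous
    rw [Real.dist_eq]
    rcases le_total p q with h | h
    · linarith [(hlip p q h).1, abs_nonneg (p - q)]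
    · linarith [(hlip q p h).2, le_abs_self (p - q)]
  have htop : Tendsto (fun n : ℕ => volume (A ∩ Set.Iio (n : ℝ))) atTop (𝓝 (volume A)) := by
    have h := tendsto_measure_iUnion_atTop (μ := volume) (s := fun n : ℕ => A ∩ Set.Iio (n : ℝ))
      (fun m n h => Set.inter_subset_inter_right _ (Set.Iio_subset_Iio (by exact_mod_cast h)))
    have hU : (⋃ n : ℕ, Set.Iio (n : ℝ)) = Set.univ :=
      Set.iUnion_eq_univ_iff.mpr fun x => exists_nat_gt x
    rwa [← Set.inter_iUnion, hU, Set.inter_univ] at h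
  have hbot : Tendsto (fun n : ℕ => volume (A ∩ Set.Iio (-(n : ℝ)))) atTop (𝓝 0) := by
    have h := tendsto_measure_iInter_atTop (μ := volume)
      (s := fun n : ℕ => A ∩ Set.Iio (-(n : ℝ)))
      (fun n => (hA.inter measurableSet_Iio).nullMeasurableSet)
      (fun m n h => Set.inter_subset_inter_right _
        (Set.Iio_subset_Iio (by simpa using h))) ⟨0, hfin _⟩
    have : (⋂ n : ℕ, A ∩ Set.Iio (-(n : ℝ))) = ∅ := by
      ext x
      simp only [Set.mem_iInter, Set.mem_inter_iff, Set.mem_Iio, Set.mem_empty_iff_false,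
        iff_false, not_forall]
      obtain ⟨n, hn⟩ := exists_nat_gt (-x)
      exact ⟨n, fun h => by linarith [h.2]⟩
    rwa [this, measure_empty] at h
  obtain ⟨n, hn⟩ := (htop.eventually (lt_mem_nhds ht)).exists
  obtain ⟨k, hk⟩ := (hbot.eventually (gt_mem_nhds (ENNReal.ofReal_pos.mpr ht0))).exists
  obtain ⟨p, hp⟩ := mem_range_of_exists_le_of_exists_ge hcont
    ⟨_, (ENNReal.toReal_lt_of_lt_ofReal hk).le⟩
    ⟨_, ((ENNReal.ofReal_lt_iff_lt_toReal ht0.le (hfin _)).mp hn).le⟩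
  refine ⟨p, ?_⟩
  rw [← hp, hF, ENNReal.ofReal_toReal (hfin _)]

theorem exists_volume_inter_Ioi_eq {B : Set ℝ} (hB : MeasurableSet B) (hB' : volume B ≠ ⊤)
    {t : ℝ} (ht0 : 0 < t) (ht : ENNReal.ofReal t < volume B) :
    ∃ q, volume (B ∩ Set.Ioi q) = ENNReal.ofReal t := by
  obtain ⟨p, hp⟩ := exists_volume_inter_Iio_eq hB.neg (by rwa [Measure.measure_neg]) ht0
    (by rwa [Measure.measure_neg])
  refine ⟨-p, ?_⟩
  rw [← hp, ← Measure.measure_neg volume (-B ∩ Set.Iio p), Set.inter_neg, neg_neg]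
  simp

theorem rieszForm_real_le {A B C : Set ℝ} (hA : MeasurableSet A) (hB : MeasurableSet B)
    (hC : MeasurableSet C) {t : ℝ≥0∞} {p q : ℝ} (hp : volume (A ∩ Set.Iio p) = t)
    (hq : volume (B ∩ Set.Ioi q) = t) :
    rieszForm A B C ≤ t * volume C + volume (A ∩ Set.Ici p) * volume (B ∩ Set.Iic q) := by
  set T : Set (ℝ × ℝ) := {z | z.1 ∈ A ∧ z.2 - z.1 ∈ B ∧ z.2 ∈ C ∧ (z.1 < p ∨ q < z.2 - z.1)}
    with hT
  have hTm : MeasurableSet T :=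
    (measurable_fst hA).inter (((measurable_snd.sub measurable_fst) hB).inter
      ((measurable_snd hC).inter ((measurableSet_lt measurable_fst measurable_const).union
        (measurableSet_lt measurable_const (measurable_snd.sub measurable_fst)))))
  have hsub : sumTriples A B C ⊆ (fun z : ℝ × ℝ => (z.1, z.1 + z.2)) ⁻¹' T ∪
      (A ∩ Set.Ici p) ×ˢ (B ∩ Set.Iic q) := by
    rintro ⟨x, y⟩ ⟨hx, hy, hxy⟩
    by_cases h : x < p ∨ q < y
    · left
      simpa [hT] using ⟨hx, hy, hxy, h⟩
    · right
      push Not at h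
      exact ⟨⟨hx, h.1⟩, ⟨hy, h.2⟩⟩
  refine (measure_mono hsub).trans ((measure_union_le _ _).trans (add_le_add ?_ ?_))
  · rw [(measurePreserving_prod_add (volume : Measure ℝ) volume).measure_preimage
      hTm.nullMeasurableSet, Measure.prod_apply_symm hTm]
    calc _ ≤ ∫⁻ z, C.indicator (fun _ => t) z := by
          refine lintegral_mono fun z => ?_
          by_cases hz : z ∈ C
          · rw [Set.indicator_of_mem hz]
            rcases le_total (z - q) p with h | h
            · rw [← hp]
              refine measure_mono ?_
              rintro x ⟨hx, -, -, hx'⟩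
              refine ⟨hx, ?_⟩
              rcases hx' with hx' | hx'
              · exact hx'
              · simp only [Set.mem_Iio] at *
                linarith
            · rw [← hq, ← (Measure.measurePreserving_sub_left volume z).measure_preimage
                (hB.inter measurableSet_Ioi).nullMeasurableSet]
              refine measure_mono ?_
              rintro x ⟨-, hx, -, hx'⟩
              refine ⟨hx, ?_⟩
              rcases hx' with hx' | hx'
              · simp only [Set.mem_Ioi] at *
                linarith
              · exact hx'
          · rw [Set.indicator_of_notMem hz]
            simp [hT, hz]
      _ = t * volume C := by simp [lintegral_indicator hC]
  · rw [Measure.prod_prod]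

theorem le_rieszForm_symmInterval {a b c : ℝ} (hab : c < a + b) (hbc : a < b + c)
    (hac : b < a + c) :
    ENNReal.ofReal ((a + b - c) / 2) * ENNReal.ofReal c +
        ENNReal.ofReal (a - (a + b - c) / 2) * ENNReal.ofReal (b - (a + b - c) / 2) ≤
      rieszForm (symmInterval (ENNReal.ofReal a)) (symmInterval (ENNReal.ofReal b))
        (symmInterval (ENNReal.ofReal c)) := by
  rw [symmInterval_ofReal, symmInterval_ofReal, symmInterval_ofReal]
  obtain ⟨t, ht⟩ : ∃ t, t = (a + b - c) / 2 := ⟨_, rfl⟩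
  rw [← ht]
  set p := -(a / 2) + t with hp
  set q := b / 2 - t with hq
  set T : Set (ℝ × ℝ) := {z | z.1 ∈ Set.Ioo (-(a / 2)) (a / 2) ∧
    z.2 - z.1 ∈ Set.Ioo (-(b / 2)) (b / 2) ∧ z.2 ∈ Set.Ioo (-(c / 2)) (c / 2) ∧
    (z.1 < p ∨ q < z.2 - z.1)} with hT
  have hTm : MeasurableSet T :=
    (measurable_fst measurableSet_Ioo).inter
      (((measurable_snd.sub measurable_fst) measurableSet_Ioo).inter
      ((measurable_snd measurableSet_Ioo).inter
        ((measurableSet_lt measurable_fst measurable_const).union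
        (measurableSet_lt measurable_const (measurable_snd.sub measurable_fst)))))
  have hsub : (fun z : ℝ × ℝ => (z.1, z.1 + z.2)) ⁻¹' T ∪
      (Set.Ioo p (a / 2)) ×ˢ (Set.Ioo (-(b / 2)) q) ⊆ 
      sumTriples (Set.Ioo (-(a / 2)) (a / 2)) (Set.Ioo (-(b / 2)) (b / 2))
        (Set.Ioo (-(c / 2)) (c / 2)) := by
    rintro ⟨x, y⟩ (⟨h1, h2, h3, -⟩ | ⟨⟨h1, h2⟩, h3, h4⟩)
    · exact ⟨h1, by simpa using h2, h3⟩
    · simp only at h1 h2 h3 h4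
      refine ⟨⟨?_, h2⟩, ⟨h3, ?_⟩, ?_, ?_⟩ <;> simp only <;> linarith
  refine le_trans ?_ (measure_mono hsub)
  rw [measure_union ?_ (measurableSet_Ioo.prod measurableSet_Ioo)]
  · gcongr ?_ + ?_
    · rw [(measurePreserving_prod_add (volume : Measure ℝ) volume).measure_preimage
        hTm.nullMeasurableSet, Measure.prod_apply_symm hTm]
      calc _ = ∫⁻ z, (Set.Ioo (-(c / 2)) (c / 2)).indicator (fun _ => ENNReal.ofReal t) z := by
            rw [lintegral_indicator measurableSet_Ioo, setLIntegral_const, Real.volume_Ioo]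
            congr 2
            ring
        _ ≤ _ := by
            refine lintegral_mono (Set.indicator_le fun z hz => ?_)
            obtain ⟨hz1, hz2⟩ := hz
            rcases le_total (z - q) p with h | h
            · calc ENNReal.ofReal t = volume (Set.Ioo (-(a / 2)) p) := by
                    rw [Real.volume_Ioo]
                    congr 1
                    ring
                _ ≤ _ := by
                    refine measure_mono ?_
                    rintro x ⟨h1, h2⟩
                    refine ⟨⟨h1, ?_⟩, ⟨?_, ?_⟩, ⟨hz1, hz2⟩, Or.inl h2⟩ <;> simp only <;> linarith
            · calc ENNReal.ofReal t = volume (Set.Ioo (z - b / 2) (z - b / 2 + t)) := by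
                    rw [Real.volume_Ioo]
                    congr 1
                    ring
                _ ≤ _ := by
                    refine measure_mono ?_
                    rintro x ⟨h1, h2⟩
                    refine ⟨⟨?_, ?_⟩, ⟨?_, ?_⟩, ⟨hz1, hz2⟩, Or.inr ?_⟩ <;> simp only <;> linarith
    · rw [Measure.prod_prod, Real.volume_Ioo, Real.volume_Ioo]
      apply le_of_eq
      congr 2 <;> ring
  · rw [Set.disjoint_left]
    rintro ⟨x, y⟩ ⟨-, -, -, h⟩ ⟨⟨h1, -⟩, -, h4⟩
    simp only at h h1 h4
    rcases h with h | h <;> linarith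

/-- The Riesz rearrangement inequality on the real line. -/
theorem rieszForm_le_symmInterval {A B C : Set ℝ} (hA : MeasurableSet A) (hB : MeasurableSet B)
    (hC : MeasurableSet C) :
    rieszForm A B C ≤ rieszForm (symmInterval (volume A)) (symmInterval (volume B))
      (symmInterval (volume C)) := by
  have key : ∀ a b c : ℝ≥0∞, a + b ≤ c → a * b ≤
      rieszForm (symmInterval a) (symmInterval b) (symmInterval c) := by
    intro a b c h
    calc a * b = volume (symmInterval a) * volume (symmInterval b) := by
          rw [volume_symmInterval, volume_symmInterval]
      _ ≤ _ := by
          rw [← Measure.prod_prod]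
          exact measure_mono fun z hz => ⟨hz.1, hz.2, add_mem_symmInterval h hz.1 hz.2⟩
  have key' : ∀ a b c : ℝ≥0∞, a + c ≤ b → a * c ≤
      rieszForm (symmInterval a) (symmInterval b) (symmInterval c) := by
    intro a b c h
    calc a * c = volume (symmInterval a) * volume (symmInterval c) := by
          rw [volume_symmInterval, volume_symmInterval]
      _ ≤ _ := by
          rw [← Measure.prod_prod, ← (measurePreserving_prod_add (volume : Measure ℝ)
            volume).measure_preimage ((measurableSet_symmInterval a).prod
            (measurableSet_symmInterval c)).nullMeasurableSet]
          refine measure_mono fun z hz => ⟨hz.1, ?_, hz.2⟩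
          have := add_mem_symmInterval h (neg_mem_symmInterval hz.1) hz.2
          simpa using this
  rcases le_or_gt (volume A + volume B) (volume C) with h1 | h1
  · exact (rieszForm_le_mul_left A B C).trans (key _ _ _ h1)
  rcases le_or_gt (volume A + volume C) (volume B) with h2 | h2
  · exact (rieszForm_le_mul_right A B C hA hC).trans (key' _ _ _ h2)
  rcases le_or_gt (volume B + volume C) (volume A) with h3 | h3
  · rw [rieszForm_comm hA hB hC, rieszForm_comm (measurableSet_symmInterval _)
      (measurableSet_symmInterval _) (measurableSet_symmInterval _)]
    exact (rieszForm_le_mul_right B A C hB hC).trans (key' _ _ _ h3)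
  have hA' : volume A ≠ ⊤ := h3.ne_top
  have hB' : volume B ≠ ⊤ := h2.ne_top
  have hC' : volume C ≠ ⊤ := h1.ne_top
  obtain ⟨a, ha⟩ : ∃ a, a = (volume A).toReal := ⟨_, rfl⟩
  obtain ⟨b, hb⟩ : ∃ b, b = (volume B).toReal := ⟨_, rfl⟩
  obtain ⟨c, hc⟩ : ∃ c, c = (volume C).toReal := ⟨_, rfl⟩
  have ha' : volume A = ENNReal.ofReal a := by rw [ha, ENNReal.ofReal_toReal hA']
  have hb' : volume B = ENNReal.ofReal b := by rw [hb, ENNReal.ofReal_toReal hB']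
  have hc' : volume C = ENNReal.ofReal c := by rw [hc, ENNReal.ofReal_toReal hC']
  have h1' : c < a + b := by
    rw [ha, hb, hc, ← ENNReal.toReal_add hA' hB']
    exact ENNReal.toReal_strict_mono (by simp [hA', hB']) h1
  have h2' : b < a + c := by
    rw [ha, hb, hc, ← ENNReal.toReal_add hA' hC']
    exact ENNReal.toReal_strict_mono (by simp [hA', hC']) h2
  have h3' : a < b + c := by
    rw [ha, hb, hc, ← ENNReal.toReal_add hB' hC']
    exact ENNReal.toReal_strict_mono (by simp [hB', hC']) h3
  have ht0 : 0 < (a + b - c) / 2 := by linarith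
  obtain ⟨p, hp⟩ := exists_volume_inter_Iio_eq hA hA' ht0
    (by rw [ha', ENNReal.ofReal_lt_ofReal_iff] <;> linarith)
  obtain ⟨q, hq⟩ := exists_volume_inter_Ioi_eq hB hB' ht0
    (by rw [hb', ENNReal.ofReal_lt_ofReal_iff] <;> linarith)
  have hpA : volume (A ∩ Set.Ici p) = ENNReal.ofReal (a - (a + b - c) / 2) := by
    have h := measure_inter_add_sdiff (μ := volume) A (measurableSet_Iio (a := p))
    rw [hp, ha', Set.sdiff_eq, Set.compl_Iio] at h
    rw [ENNReal.ofReal_sub _ ht0.le, ← h, ENNReal.add_sub_cancel_left (by simp)]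
  have hqB : volume (B ∩ Set.Iic q) = ENNReal.ofReal (b - (a + b - c) / 2) := by
    have h := measure_inter_add_sdiff (μ := volume) B (measurableSet_Ioi (a := q))
    rw [hq, hb', Set.sdiff_eq, Set.compl_Ioi] at h
    rw [ENNReal.ofReal_sub _ ht0.le, ← h, ENNReal.add_sub_cancel_left (by simp)]
  refine (rieszForm_real_le hA hB hC hp hq).trans ?_
  rw [hpA, hqB, ha', hb', hc']
  exact le_rieszForm_symmInterval h1' h3' h2'

end Line

section Steiner

instance Prod.instMeasurableAdd₂ {G H : Type*} [MeasurableSpace G] [MeasurableSpace H] [Add G]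
    [Add H] [MeasurableAdd₂ G] [MeasurableAdd₂ H] : MeasurableAdd₂ (G × H) :=
  ⟨((measurable_fst.fst.add measurable_snd.fst).prodMk
    (measurable_fst.snd.add measurable_snd.snd))⟩

variable {W : Type*} [MeasureSpace W]

/-- Steiner symmetrization of a subset of `ℝ × W` in the direction of the first factor. -/
noncomputable def steiner (A : Set (ℝ × W)) : Set (ℝ × W) :=
  {p | p.1 ∈ symmInterval (volume ((fun s : ℝ => (s, p.2)) ⁻¹' A))}

theorem measurableSet_steiner {A : Set (ℝ × W)} (hA : MeasurableSet A) :
    MeasurableSet (steiner A) :=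
  measurableSet_lt (f := fun p : ℝ × W => ENNReal.ofReal (2 * |p.1|)) (by fun_prop)
    ((measurable_measure_prodMk_right hA).comp measurable_snd)

theorem preimage_steiner {W : Type*} (A : Set (ℝ × W)) (w : W) :
    (fun s : ℝ => (s, w)) ⁻¹' steiner A =
      symmInterval (volume ((fun s : ℝ => (s, w)) ⁻¹' A)) := rfl

variable [SFinite (volume : Measure W)]

theorem volume_steiner {A : Set (ℝ × W)} (hA : MeasurableSet A) :
    volume (steiner A) = volume A := by
  rw [Measure.volume_eq_prod, Measure.prod_apply_symm (measurableSet_steiner hA),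
    Measure.prod_apply_symm hA]
  simp_rw [preimage_steiner, volume_symmInterval]

variable [AddCommGroup W] [MeasurableAdd₂ W]

theorem rieszForm_prod {A B C : Set (ℝ × W)} (hA : MeasurableSet A) (hB : MeasurableSet B)
    (hC : MeasurableSet C) :
    rieszForm A B C = ∫⁻ w, ∫⁻ w', rieszForm ((fun s : ℝ => (s, w)) ⁻¹' A)
      ((fun s : ℝ => (s, w')) ⁻¹' B) ((fun s : ℝ => (s, w + w')) ⁻¹' C) := by
  have hm := measurableSet_sumTriples hA hB hC
  set F : (ℝ × W) × (ℝ × W) → ℝ≥0∞ := (sumTriples A B C).indicator 1 with hF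
  have hFm : Measurable F := measurable_one.indicator hm
  calc rieszForm A B C = ∫⁻ z, F z ∂(volume.prod volume) := by
        rw [hF, lintegral_indicator_one hm, rieszForm]
    _ = ∫⁻ p : ℝ × W, ∫⁻ q : ℝ × W, F (p, q) := lintegral_prod _ hFm.aemeasurable
    _ = ∫⁻ w, ∫⁻ s, ∫⁻ q : ℝ × W, F ((s, w), q) := by
        rw [Measure.volume_eq_prod]
        exact lintegral_prod_symm _ hFm.lintegral_prod_right'.aemeasurable
    _ = ∫⁻ w, ∫⁻ s, ∫⁻ w', ∫⁻ s', F ((s, w), (s', w')) := by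
        refine lintegral_congr fun w => lintegral_congr fun s => ?_
        rw [Measure.volume_eq_prod]
        exact lintegral_prod_symm (fun q => F ((s, w), q))
          (hFm.comp measurable_prodMk_left).aemeasurable
    _ = ∫⁻ w, ∫⁻ w', ∫⁻ s, ∫⁻ s', F ((s, w), (s', w')) := by
        refine lintegral_congr fun w => ?_
        refine lintegral_lintegral_swap ?_
        refine Measurable.aemeasurable ?_
        refine Measurable.lintegral_prod_right' (ν := volume)
          (f := fun z : (ℝ × W) × ℝ => F ((z.1.1, w), (z.2, z.1.2))) ?_
        exact hFm.comp (by fun_prop)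
    _ = _ := by
        refine lintegral_congr fun w => lintegral_congr fun w' => ?_
        have hm' := measurableSet_sumTriples (measurable_prodMk_right (y := w) hA)
          (measurable_prodMk_right (y := w') hB) (measurable_prodMk_right (y := w + w') hC)
        rw [rieszForm, ← lintegral_indicator_one hm',
          lintegral_prod _ (measurable_one.indicator hm').aemeasurable]
        rfl

theorem rieszForm_le_steiner {A B C : Set (ℝ × W)} (hA : MeasurableSet A) (hB : MeasurableSet B)
    (hC : MeasurableSet C) :
    rieszForm A B C ≤ rieszForm (steiner A) (steiner B) (steiner C) := by
  rw [rieszForm_prod hA hB hC, rieszForm_prod (measurableSet_steiner hA)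
    (measurableSet_steiner hB) (measurableSet_steiner hC)]
  exact lintegral_mono fun w => lintegral_mono fun w' =>
    rieszForm_le_symmInterval (measurable_prodMk_right hA)
      (measurable_prodMk_right hB) (measurable_prodMk_right hC)

theorem volume_symmInterval_inter {K : Set ℝ} (hK : ∀ s ∈ K, ∀ s', |s'| ≤ |s| → s' ∈ K)
    (a : ℝ≥0∞) : volume (symmInterval a ∩ K) = min a (volume K) := by
  have h : symmInterval a ⊆ K ∨ K ⊆ symmInterval a := by
    by_contra! h
    obtain ⟨⟨x, hx, hx'⟩, y, hy, hy'⟩ := And.imp Set.not_subset.mp Set.not_subset.mp h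
    rcases le_total |x| |y| with h | h
    · exact hx' (hK y hy x h)
    · exact hy' (mem_symmInterval_of_abs_le hx h)
  rcases h with h | h
  · rw [Set.inter_eq_left.mpr h, volume_symmInterval, min_eq_left]
    rw [← volume_symmInterval a]
    exact measure_mono h
  · rw [Set.inter_eq_right.mpr h, min_eq_right]
    rw [← volume_symmInterval a]
    exact measure_mono h

/-- Steiner symmetrization increases the overlap with a symmetric set `K` at least by the mass that
a translation along the symmetrization axis moves from `A \ K` to `K \ A`. -/
theorem add_volume_le_volume_steiner_inter {A K : Set (ℝ × W)} (hA : MeasurableSet A)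
    (hK : MeasurableSet K) (hK' : ∀ p ∈ K, ∀ s, |s| ≤ |p.1| → (s, p.2) ∈ K) (r : ℝ) :
    volume (A ∩ K) + volume (A \ K ∩ (fun p => p + (r, 0)) ⁻¹' (K \ A)) ≤
      volume (steiner A ∩ K) := by
  have hm : MeasurableSet (A \ K ∩ (fun p => p + (r, (0 : W))) ⁻¹' (K \ A)) :=
    (hA.diff hK).inter ((measurable_add_const (r, (0 : W))) (hK.diff hA))
  rw [Measure.volume_eq_prod, Measure.prod_apply_symm (hA.inter hK), Measure.prod_apply_symm hm,
    Measure.prod_apply_symm ((measurableSet_steiner hA).inter hK),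
    ← lintegral_add_left (measurable_measure_prodMk_right (hA.inter hK))]
  refine lintegral_mono fun w => ?_
  set Aw := (fun s : ℝ => (s, w)) ⁻¹' A with hAw
  set Kw := (fun s : ℝ => (s, w)) ⁻¹' K with hKw
  have hAm : MeasurableSet Aw := measurable_prodMk_right hA
  have hKm : MeasurableSet Kw := measurable_prodMk_right hK
  have h1 : (fun s : ℝ => (s, w)) ⁻¹' (steiner A ∩ K) = symmInterval (volume Aw) ∩ Kw := rfl
  have h2 : (fun s : ℝ => (s, w)) ⁻¹' (A \ K ∩ (fun p => p + (r, (0 : W))) ⁻¹' (K \ A)) =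
      Aw \ Kw ∩ (fun s => s + r) ⁻¹' (Kw \ Aw) := by
    ext s
    simp [hAw, hKw]
  rw [h1, h2, Set.preimage_inter,
    volume_symmInterval_inter (K := Kw) fun s hs s' h => hK' (s, w) hs s' h]
  refine le_min ?_ ?_
  · rw [← measure_inter_add_sdiff Aw hKm]
    gcongr
    exact Set.inter_subset_left
  · rw [← measure_inter_add_sdiff Kw hAm, Set.inter_comm Kw Aw,
      ← measure_preimage_add_right volume r (Kw \ Aw)]
    gcongr
    exact Set.inter_subset_right

end Steiner

section Euclidean

variable {E : Type*} [NormedAddCommGroup E] [InnerProductSpace ℝ E] [FiniteDimensional ℝ E]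
  [MeasurableSpace E] [BorelSpace E]

theorem exists_measurableEquiv_prod_orthogonal {v : E} (hv : v ≠ 0) :
    ∃ e : (ℝ × (ℝ ∙ v)ᗮ) ≃ᵐ E, MeasurePreserving e ∧ (∀ p q, e (p + q) = e p + e q) ∧
      e (‖v‖, 0) = v ∧ ∀ p, ‖e p‖ ^ 2 = p.1 ^ 2 + ‖p.2‖ ^ 2 := by
  set u : E := ‖v‖⁻¹ • v with hu
  have hv' : ‖v‖ ≠ 0 := norm_ne_zero_iff.mpr hv
  have hu1 : ‖u‖ = 1 := by rw [hu, norm_smul, norm_inv, norm_norm, inv_mul_cancel₀ hv']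
  have hspan : (ℝ ∙ u) = (ℝ ∙ v) := Submodule.span_singleton_smul_eq (by simpa using hv') v
  rw [← hspan]
  let e₁ : ℝ ≃ₗᵢ[ℝ] (ℝ ∙ u) := LinearIsometryEquiv.toSpanUnitSingleton u hu1
  let e₂ : (ℝ × (ℝ ∙ u)ᗮ) ≃ᵐ (ℝ ∙ u) × (ℝ ∙ u)ᗮ :=
    MeasurableEquiv.prodCongr e₁.toMeasurableEquiv (MeasurableEquiv.refl _)
  have he₂ : MeasurePreserving e₂ := e₁.measurePreserving.prod (MeasurePreserving.id _)
  let e₃ : (ℝ ∙ u) × (ℝ ∙ u)ᗮ ≃ᵐ E :=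
    (MeasurableEquiv.toLp 2 _).trans (ℝ ∙ u).orthogonalDecomposition.toMeasurableEquiv.symm
  have he₃ : MeasurePreserving e₃ :=
    (WithLp.volume_preserving_toLp _ _).trans (ℝ ∙ u).orthogonalDecomposition.symm.measurePreserving
  have he : ∀ p, (e₂.trans e₃) p = p.1 • u + p.2 := by
    intro p
    simp [e₂, e₃, e₁]
    rfl
  refine ⟨e₂.trans e₃, he₂.trans he₃, ?_, ?_, ?_⟩
  · intro p q
    rw [he, he, he]
    simp only [Prod.fst_add, Prod.snd_add, Submodule.coe_add, add_smul]
    abel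
  · rw [he]
    simp [hu, smul_smul, hv']
  · intro p
    rw [he]
    have : inner ℝ (p.1 • u) (p.2 : E) = 0 := by
      rw [inner_smul_left, Submodule.mem_orthogonal_singleton_iff_inner_right.mp p.2.2, mul_zero]
    rw [norm_add_sq_real, this, norm_smul, hu1]
    simp

theorem exists_symmetrization (v : E) :
    ∃ S : Set E → Set E, (∀ A, MeasurableSet A → MeasurableSet (S A) ∧ volume (S A) = volume A ∧
      ∀ r, volume (A ∩ Metric.ball 0 r) +
        volume (A \ Metric.ball 0 r ∩ (fun x => x + v) ⁻¹' (Metric.ball 0 r \ A)) ≤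
        volume (S A ∩ Metric.ball 0 r)) ∧
      ∀ A B C, MeasurableSet A → MeasurableSet B → MeasurableSet C →
        rieszForm A B C ≤ rieszForm (S A) (S B) (S C) := by
  rcases eq_or_ne v 0 with rfl | hv
  · refine ⟨id, fun A hA => ⟨hA, rfl, fun r => ?_⟩, fun _ _ _ _ _ _ => le_rfl⟩
    have : A \ Metric.ball 0 r ∩ (fun x => x + 0) ⁻¹' (Metric.ball 0 r \ A) = ∅ := by
      ext x
      simp
      tauto
    rw [this, measure_empty, add_zero, id]
  · obtain ⟨e, he, hadd, hev, hnorm⟩ := exists_measurableEquiv_prod_orthogonal hv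
    have hvol : ∀ A, volume (e ⁻¹' A) = volume A := fun A => he.measure_preimage_equiv A
    have hriesz : ∀ A B C : Set E, MeasurableSet A → MeasurableSet B → MeasurableSet C →
        rieszForm (e ⁻¹' A) (e ⁻¹' B) (e ⁻¹' C) = rieszForm A B C := by
      intro A B C hA hB hC
      rw [rieszForm, rieszForm, ← (he.prod he).measure_preimage
        (measurableSet_sumTriples hA hB hC).nullMeasurableSet]
      congr 1
      ext p
      simp [sumTriples, hadd]
    refine ⟨fun A => e '' steiner (e ⁻¹' A), fun A hA => ⟨?_, ?_, fun r => ?_⟩,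
      fun A B C hA hB hC => ?_⟩
    · exact e.measurableSet_image.mpr (measurableSet_steiner (e.measurable hA))
    · rw [← hvol, e.preimage_image, volume_steiner (e.measurable hA), hvol]
    · rw [← hvol (A ∩ _), ← hvol (_ ∩ _ ⁻¹' _), ← hvol (_ '' _ ∩ _)]
      have := add_volume_le_volume_steiner_inter (e.measurable hA)
        (e.measurable (measurableSet_ball (x := (0 : E)) (ε := r))) ?_ ‖v‖
      · have h1 : e ⁻¹' (e '' steiner (e ⁻¹' A) ∩ Metric.ball 0 r) =
            steiner (e ⁻¹' A) ∩ e ⁻¹' Metric.ball 0 r := by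
          rw [Set.preimage_inter, e.preimage_image]
        have h2 : e ⁻¹' (A \ Metric.ball 0 r ∩ (fun x => x + v) ⁻¹' (Metric.ball 0 r \ A)) =
            e ⁻¹' A \ e ⁻¹' Metric.ball 0 r ∩
              (fun p => p + (‖v‖, 0)) ⁻¹' (e ⁻¹' Metric.ball 0 r \ e ⁻¹' A) := by
          ext p
          simp only [Set.mem_inter_iff, Set.mem_sdiff, Set.mem_preimage, hadd, hev]
        rw [h1, h2]
        exact this
      · intro p hp s hs
        simp only [Set.mem_preimage, mem_ball_zero_iff] at hp ⊢
        refine lt_of_le_of_lt ?_ hp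
        rw [← sq_le_sq₀ (norm_nonneg _) (norm_nonneg _), hnorm, hnorm]
        have := sq_le_sq.mpr hs
        simpa using this
    · rw [← hriesz A B C hA hB hC, ← hriesz (_ '' _) (_ '' _) (_ '' _)]
      · simp only [e.preimage_image]
        exact rieszForm_le_steiner (e.measurable hA) (e.measurable hB) (e.measurable hC)
      all_goals exact e.measurableSet_image.mpr (measurableSet_steiner (e.measurable ‹_›))

end Euclidean

section General

variable {G : Type*} [MeasureSpace G] [AddCommGroup G]

theorem rieszForm_le_add₁ [SFinite (volume : Measure G)] (A K B C : Set G) :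
    rieszForm A B C ≤ rieszForm K B C + volume (A \ K) * volume B := by
  calc rieszForm A B C ≤ rieszForm K B C + rieszForm (A \ K) B C := by
        refine (measure_mono fun p hp => ?_).trans (measure_union_le _ _)
        by_cases h : p.1 ∈ K
        · exact Or.inl ⟨h, hp.2⟩
        · exact Or.inr ⟨⟨hp.1, h⟩, hp.2⟩
    _ ≤ _ := by gcongr; exact rieszForm_le_mul_left _ _ _

theorem rieszForm_le_add₂ [SFinite (volume : Measure G)] (A B K C : Set G) :
    rieszForm A B C ≤ rieszForm A K C + volume A * volume (B \ K) := by
  calc rieszForm A B C ≤ rieszForm A K C + rieszForm A (B \ K) C := by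
        refine (measure_mono fun p hp => ?_).trans (measure_union_le _ _)
        by_cases h : p.2 ∈ K
        · exact Or.inl ⟨hp.1, h, hp.2.2⟩
        · exact Or.inr ⟨hp.1, ⟨hp.2.1, h⟩, hp.2.2⟩
    _ ≤ _ := by gcongr; exact rieszForm_le_mul_left _ _ _

theorem rieszForm_le_add₃ [SFinite (volume : Measure G)] [MeasurableAdd₂ G]
    [(volume : Measure G).IsAddLeftInvariant] {A C K : Set G} (B : Set G)
    (hA : MeasurableSet A) (hC : MeasurableSet C) (hK : MeasurableSet K) :
    rieszForm A B C ≤ rieszForm A B K + volume A * volume (C \ K) := by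
  calc rieszForm A B C ≤ rieszForm A B K + rieszForm A B (C \ K) := by
        refine (measure_mono fun p hp => ?_).trans (measure_union_le _ _)
        by_cases h : p.1 + p.2 ∈ K
        · exact Or.inl ⟨hp.1, hp.2.1, h⟩
        · exact Or.inr ⟨hp.1, hp.2.1, hp.2.2, h⟩
    _ ≤ _ := by gcongr; exact rieszForm_le_mul_right _ _ _ hA (hC.diff hK)

end General

section Euclidean

variable {E : Type*} [NormedAddCommGroup E] [InnerProductSpace ℝ E] [FiniteDimensional ℝ E]
  [MeasurableSpace E] [BorelSpace E]

/-- If every translate of `U` meets `F` in measure at most `ε`, then one of `U`, `F` is small. -/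
theorem volume_mul_volume_le_of_forall_inter_le {U F : Set E} {R : ℝ} {ε : ℝ≥0∞}
    (hU : MeasurableSet U) (hF : MeasurableSet F) (hUR : volume (U \ Metric.ball 0 R) = 0)
    (hFR : F ⊆ Metric.ball 0 R) (h : ∀ v, volume (U ∩ (fun x => x + v) ⁻¹' F) ≤ ε) :
    volume U * volume F ≤ ε * volume (Metric.ball (0 : E) (2 * R)) := by
  have hU' : MeasurableSet (U ∩ Metric.ball 0 R) := hU.inter measurableSet_ball
  have h1 : volume U = volume (U ∩ Metric.ball 0 R) := by
    rw [← measure_inter_add_sdiff U (measurableSet_ball (x := (0 : E)) (ε := R)), hUR, add_zero]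
  have h2 : (fun z : E × E => (z.1, z.1 + z.2)) ⁻¹' ((U ∩ Metric.ball 0 R) ×ˢ F) =
      sumTriples (U ∩ Metric.ball 0 R) (Metric.ball 0 (2 * R)) F := by
    ext p
    simp only [Set.mem_preimage, Set.mem_prod, sumTriples, Set.mem_ofPred_eq]
    refine ⟨fun hp => ⟨hp.1, ?_, hp.2⟩, fun hp => ⟨hp.1, hp.2.2⟩⟩
    have h3 := mem_ball_zero_iff.mp hp.1.2
    have h4 := mem_ball_zero_iff.mp (hFR hp.2)
    rw [mem_ball_zero_iff]
    have h5 := norm_sub_le (p.1 + p.2) p.1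
    rw [add_sub_cancel_left] at h5
    linarith
  rw [h1, ← Measure.prod_prod, ← (measurePreserving_prod_add (volume : Measure E)
    (volume : Measure E)).measure_preimage (hU'.prod hF).nullMeasurableSet, h2,
    Measure.prod_apply_symm (measurableSet_sumTriples hU' measurableSet_ball hF),
    ← lintegral_indicator_const measurableSet_ball]
  refine lintegral_mono fun v => ?_
  by_cases hv : v ∈ Metric.ball (0 : E) (2 * R)
  · rw [Set.indicator_of_mem hv]
    refine (measure_mono (t := U ∩ (fun x => x + v) ⁻¹' F) fun x hx => ?_).trans (h v)
    exact ⟨hx.1.1, hx.2.2⟩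
  · rw [Set.indicator_of_notMem hv, nonpos_iff_eq_zero]
    convert measure_empty (μ := (volume : Measure E))
    ext x
    simp [sumTriples, -Metric.mem_ball, hv]

/-- A competitor of `A` in the Riesz inequality that almost maximizes the overlap with balls. -/
theorem exists_rieszForm_le_volume_sdiff_le {A : Fin 3 → Set E} {a : Fin 3 → ℝ} {R : ℝ}
    (hA : ∀ i, MeasurableSet (A i)) (hAR : ∀ i, A i ⊆ Metric.ball 0 R) (haR : ∀ i, a i ≤ R)
    (ha : ∀ i, volume (Metric.ball (0 : E) (a i)) = volume (A i)) {η : ℝ≥0∞} (hη : η ≠ 0) :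
    ∃ T : Fin 3 → Set E, (∀ i, MeasurableSet (T i) ∧ volume (T i) = volume (A i) ∧
      volume (T i \ Metric.ball 0 (a i)) ≤ η) ∧
      rieszForm (A 0) (A 1) (A 2) ≤ rieszForm (T 0) (T 1) (T 2) := by
  set V := volume (Metric.ball (0 : E) (2 * R)) with hV
  have hVtop : V + 1 ≠ ⊤ := by simp [hV, measure_ball_lt_top.ne]
  have hV0 : V + 1 ≠ 0 := by simp
  set ε := η ^ 2 / (V + 1) with hε
  have hε0 : ε ≠ 0 := (ENNReal.div_pos (pow_ne_zero 2 hη) hVtop).ne'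
  have hεV : ε * V ≤ η ^ 2 := by
    calc ε * V ≤ ε * (V + 1) := by gcongr; exact le_self_add
      _ = η ^ 2 := ENNReal.div_mul_cancel hV0 hVtop
  set Q : Set (Fin 3 → Set E) := {T | (∀ i, MeasurableSet (T i) ∧ volume (T i) = volume (A i) ∧
      volume (T i \ Metric.ball 0 R) = 0) ∧
      rieszForm (A 0) (A 1) (A 2) ≤ rieszForm (T 0) (T 1) (T 2)} with hQ
  have hAQ : A ∈ Q := ⟨fun i => ⟨hA i, rfl, by simp [Set.sdiff_eq_empty.mpr (hAR i)]⟩, le_rfl⟩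
  let M : (Fin 3 → Set E) → ℝ≥0∞ := fun T => ∑ i, volume (T i ∩ Metric.ball 0 (a i))
  set s := ⨆ T ∈ Q, M T with hs
  have hsM : ∀ T ∈ Q, M T ≤ s := fun T hT => le_iSup₂_of_le T hT le_rfl
  have hsb : s ≤ ∑ i, volume (Metric.ball (0 : E) (a i)) :=
    iSup₂_le fun T _ => Finset.sum_le_sum fun i _ => measure_mono Set.inter_subset_right
  have hs_top : s ≠ ⊤ :=
    (hsb.trans_lt (ENNReal.sum_lt_top.mpr fun i _ => measure_ball_lt_top)).ne
  obtain ⟨T, hT, hTs⟩ : ∃ T ∈ Q, s ≤ M T + ε := by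
    by_contra! hcon
    have h1 : s ≤ s - ε := iSup₂_le fun T hT =>
      ENNReal.le_sub_of_add_le_right (ne_top_of_le_ne_top hs_top
        (le_add_self.trans (hcon A hAQ).le)) (hcon T hT).le
    exact absurd h1 (ENNReal.sub_lt_self hs_top (ne_zero_of_lt (hcon A hAQ)) hε0).not_ge
  have hMT : M T ≠ ⊤ := ne_top_of_le_ne_top hs_top (hsM T hT)
  refine ⟨T, fun i => ⟨(hT.1 i).1, (hT.1 i).2.1, ?_⟩, hT.2⟩
  have hshift : ∀ v, volume (T i \ Metric.ball 0 (a i) ∩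
      (fun x => x + v) ⁻¹' (Metric.ball 0 (a i) \ T i)) ≤ ε := by
    intro v
    obtain ⟨S, hS, hSJ⟩ := exists_symmetrization v
    have hSQ : (fun i => S (T i)) ∈ Q := by
      refine ⟨fun i => ?_, hT.2.trans (hSJ _ _ _ (hT.1 0).1 (hT.1 1).1 (hT.1 2).1)⟩
      obtain ⟨h1, h2, h3⟩ := hS (T i) (hT.1 i).1
      refine ⟨h1, h2.trans (hT.1 i).2.1, ?_⟩
      have h4 := measure_inter_add_sdiff (μ := volume) (T i)
        (measurableSet_ball (x := (0 : E)) (ε := R))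
      have h5 := measure_inter_add_sdiff (μ := volume) (S (T i))
        (measurableSet_ball (x := (0 : E)) (ε := R))
      rw [(hT.1 i).2.2, add_zero] at h4
      have h6 : volume (S (T i) ∩ Metric.ball 0 R) + volume (S (T i) \ Metric.ball 0 R) ≤
          volume (S (T i) ∩ Metric.ball 0 R) + 0 := by
        rw [h5, h2, ← h4, add_zero]
        exact le_self_add.trans (h3 R)
      exact nonpos_iff_eq_zero.mp ((ENNReal.add_le_add_iff_left
        (measure_ne_top_of_subset Set.inter_subset_right measure_ball_lt_top.ne)).mp h6)
    have h1 := (hsM _ hSQ).trans hTs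
    have h2 : M T + ∑ i, volume (T i \ Metric.ball 0 (a i) ∩
        (fun x => x + v) ⁻¹' (Metric.ball 0 (a i) \ T i)) ≤ M T + ε := by
      refine le_trans ?_ h1
      rw [← Finset.sum_add_distrib]
      exact Finset.sum_le_sum fun i _ => (hS (T i) (hT.1 i).1).2.2 (a i)
    exact (Finset.single_le_sum_of_canonicallyOrdered (Finset.mem_univ i)).trans
      ((ENNReal.add_le_add_iff_left hMT).mp h2)
  have hTm := (hT.1 i).1
  have h1 : volume (T i \ Metric.ball 0 (a i)) = volume (Metric.ball 0 (a i) \ T i) := by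
    have h2 := measure_inter_add_sdiff (μ := volume) (T i)
        (measurableSet_ball (x := (0 : E)) (ε := a i))
    have h3 := measure_inter_add_sdiff (μ := volume) (Metric.ball (0 : E) (a i)) hTm
    rw [(hT.1 i).2.1, ← ha i, ← h3, Set.inter_comm] at h2
    exact (ENNReal.add_right_inj
      (measure_ne_top_of_subset Set.inter_subset_left measure_ball_lt_top.ne)).mp h2
  have h2 := volume_mul_volume_le_of_forall_inter_le (hTm.diff measurableSet_ball)
    (measurableSet_ball.diff hTm)
    (measure_mono_null (Set.sdiff_subset_sdiff_left Set.sdiff_subset) (hT.1 i).2.2)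
    (Set.sdiff_subset.trans (Metric.ball_subset_ball (haR i))) hshift
  rw [← h1, ← sq] at h2
  exact (ENNReal.pow_le_pow_left_iff two_ne_zero).mp (h2.trans hεV)

/-- The **Riesz rearrangement inequality** for bounded sets. -/
theorem rieszForm_le_ball {A : Fin 3 → Set E} {a : Fin 3 → ℝ} {R : ℝ}
    (hA : ∀ i, MeasurableSet (A i)) (hAR : ∀ i, A i ⊆ Metric.ball 0 R) (haR : ∀ i, a i ≤ R)
    (ha : ∀ i, volume (Metric.ball (0 : E) (a i)) = volume (A i)) :
    rieszForm (A 0) (A 1) (A 2) ≤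
      rieszForm (Metric.ball (0 : E) (a 0)) (Metric.ball 0 (a 1)) (Metric.ball 0 (a 2)) := by
  have hfin : ∀ i, volume (A i) ≠ ⊤ := fun i =>
    measure_ne_top_of_subset (hAR i) measure_ball_lt_top.ne
  set c := volume (A 1) + volume (A 0) + volume (A 0) + 1 with hc
  have hc0 : c ≠ 0 := by simp [hc]
  have hctop : c ≠ ⊤ := by simp [hc, hfin]
  refine ENNReal.le_of_forall_pos_le_add fun δ hδ _ => ?_
  obtain ⟨T, hT, hJ⟩ := exists_rieszForm_le_volume_sdiff_le hA hAR haR ha (η := δ / c)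
    (ENNReal.div_pos (by simpa using hδ.ne') hctop).ne'
  calc rieszForm (A 0) (A 1) (A 2) ≤ rieszForm (T 0) (T 1) (T 2) := hJ
    _ ≤ rieszForm (Metric.ball (0 : E) (a 0)) (T 1) (T 2) + δ / c * volume (A 1) := by
        refine (rieszForm_le_add₁ _ (Metric.ball 0 (a 0)) _ _).trans ?_
        rw [(hT 1).2.1]
        gcongr
        exact (hT 0).2.2
    _ ≤ (rieszForm (Metric.ball (0 : E) (a 0)) (Metric.ball 0 (a 1)) (T 2) +
        volume (A 0) * (δ / c)) +
        δ / c * volume (A 1) := by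
        gcongr
        refine (rieszForm_le_add₂ _ _ (Metric.ball 0 (a 1)) _).trans ?_
        rw [ha 0]
        gcongr
        exact (hT 1).2.2
    _ ≤ ((rieszForm (Metric.ball (0 : E) (a 0)) (Metric.ball 0 (a 1)) (Metric.ball 0 (a 2)) +
        volume (A 0) * (δ / c)) + volume (A 0) * (δ / c)) + δ / c * volume (A 1) := by
        gcongr
        refine (rieszForm_le_add₃ _ measurableSet_ball (hT 2).1
          (measurableSet_ball (x := (0 : E)) (ε := a 2))).trans ?_
        rw [ha 0]
        gcongr
        exact (hT 2).2.2
    _ = rieszForm (Metric.ball (0 : E) (a 0)) (Metric.ball 0 (a 1)) (Metric.ball 0 (a 2)) +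
        δ / c * (volume (A 1) + volume (A 0) + volume (A 0)) := by ring
    _ ≤ _ := by
        gcongr
        calc δ / c * (volume (A 1) + volume (A 0) + volume (A 0)) ≤ δ / c * c := by
              gcongr
              exact le_self_add
          _ = δ := ENNReal.div_mul_cancel hc0 hctop

end Euclidean

section BallStar

variable {d : ℕ}

local notation "𝔼" => EuclideanSpace ℝ (Fin d)

theorem symmRadius_nonneg (A : Set 𝔼) : 0 ≤ symmRadius A :=
  Real.rpow_nonneg ENNReal.toReal_nonneg _

theorem measurableSet_ballStar (A : Set 𝔼) : MeasurableSet (ballStar A) := measurableSet_ball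

theorem volume_ballStar (hd : 1 ≤ d) {A : Set 𝔼} (hA : volume A ≠ ⊤) :
    volume (ballStar A) = volume A := by
  have h0 : volume (Metric.ball (0 : 𝔼) 1) ≠ 0 := (Metric.measure_ball_pos _ _ one_pos).ne'
  have ht : volume (Metric.ball (0 : 𝔼) 1) ≠ ⊤ := measure_ball_lt_top.ne
  have hd' : d ≠ 0 := by omega
  have : Nonempty (Fin d) := ⟨⟨0, hd⟩⟩
  rw [ballStar, Measure.addHaar_ball _ _ (symmRadius_nonneg A), finrank_euclideanSpace_fin,
    symmRadius, one_div, Real.rpow_inv_natCast_pow ENNReal.toReal_nonneg hd',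
    ENNReal.ofReal_toReal (ENNReal.div_ne_top hA h0), ENNReal.div_mul_cancel h0 ht]

theorem symmRadius_mono {A B : Set 𝔼} (h : volume A ≤ volume B) (hB : volume B ≠ ⊤) :
    symmRadius A ≤ symmRadius B := by
  have h0 : volume (Metric.ball (0 : 𝔼) 1) ≠ 0 := (Metric.measure_ball_pos _ _ one_pos).ne'
  refine Real.rpow_le_rpow ENNReal.toReal_nonneg ?_ (by positivity)
  exact ENNReal.toReal_mono (ENNReal.div_ne_top hB h0) (by gcongr)

theorem ballStar_mono {A B : Set 𝔼} (h : volume A ≤ volume B) (hB : volume B ≠ ⊤) :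
    ballStar A ⊆ ballStar B :=
  Metric.ball_subset_ball (symmRadius_mono h hB)

/-- The **Riesz rearrangement inequality** for sets of finite measure. -/
theorem rieszForm_le_ballStar (hd : 1 ≤ d) {A B C : Set 𝔼} (hA : MeasurableSet A)
    (hB : MeasurableSet B) (hC : MeasurableSet C) (hA' : volume A ≠ ⊤) (hB' : volume B ≠ ⊤)
    (hC' : volume C ≠ ⊤) :
    rieszForm A B C ≤ rieszForm (ballStar A) (ballStar B) (ballStar C) := by
  let T : ℕ → Set 𝔼 → Set 𝔼 := fun n X => X ∩ Metric.ball 0 n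
  have hT : ∀ X, Monotone fun n => T n X := fun X m n h =>
    Set.inter_subset_inter_right _ (Metric.ball_subset_ball (by exact_mod_cast h))
  have hU : sumTriples A B C = ⋃ n, sumTriples (T n A) (T n B) (T n C) := by
    ext p
    simp only [sumTriples, Set.mem_ofPred_eq, Set.mem_iUnion, T, Set.mem_inter_iff,
      mem_ball_zero_iff]
    refine ⟨fun hp => ?_, fun ⟨n, hp⟩ => ⟨hp.1.1, hp.2.1.1, hp.2.2.1⟩⟩
    obtain ⟨n, hn⟩ := exists_nat_gt (‖p.1‖ + ‖p.2‖)
    have h1 := norm_nonneg p.1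
    have h2 := norm_nonneg p.2
    exact ⟨n, ⟨hp.1, by linarith⟩, ⟨hp.2.1, by linarith⟩, hp.2.2, (norm_add_le _ _).trans_lt hn⟩
  have hmono : Monotone fun n => sumTriples (T n A) (T n B) (T n C) := fun m n h =>
    sumTriples_mono (hT A h) (hT B h) (hT C h)
  rw [rieszForm, hU, hmono.measure_iUnion]
  refine iSup_le fun n => ?_
  let X : Fin 3 → Set 𝔼 := ![A, B, C]
  have hX : ∀ i, MeasurableSet (X i) := by simp [X, Fin.forall_fin_succ, *]
  have hX' : ∀ i, volume (X i) ≠ ⊤ := by simp [X, Fin.forall_fin_succ, *]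
  have hXn : ∀ i, volume (T n (X i)) ≠ ⊤ := fun i =>
    measure_ne_top_of_subset Set.inter_subset_left (hX' i)
  have hle : ∀ i, ballStar (T n (X i)) ⊆ ballStar (X i) := fun i =>
    ballStar_mono (measure_mono Set.inter_subset_left) (hX' i)
  set R : ℝ := n + ∑ i, symmRadius (T n (X i)) with hR
  have hR1 : (n : ℝ) ≤ R :=
    le_add_of_nonneg_right (Finset.sum_nonneg fun i _ => symmRadius_nonneg _)
  have hR2 : ∀ i, symmRadius (T n (X i)) ≤ R := fun i =>
    (Finset.single_le_sum (f := fun i => symmRadius (T n (X i)))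
      (fun i _ => symmRadius_nonneg _) (Finset.mem_univ i)).trans
      (le_add_of_nonneg_left n.cast_nonneg)
  calc _ ≤ rieszForm (ballStar (T n (X 0))) (ballStar (T n (X 1))) (ballStar (T n (X 2))) :=
        rieszForm_le_ball (A := fun i => T n (X i)) (R := R)
          (fun i => (hX i).inter measurableSet_ball)
          (fun i => Set.inter_subset_right.trans (Metric.ball_subset_ball hR1)) hR2
          (fun i => volume_ballStar hd (hXn i))
    _ ≤ _ := rieszForm_mono (hle 0) (hle 1) (hle 2)

end BallStar

section LayerCake

theorem lintegral_indicator_ofReal_lt {X : Type*} (u : X → ℝ≥0∞) (x : X) :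
    ∫⁻ t in Set.Ioi (0 : ℝ), {y | ENNReal.ofReal t < u y}.indicator (fun _ => (1 : ℝ≥0∞)) x =
      u x := by
  have h1 : ∀ t, {y | ENNReal.ofReal t < u y}.indicator (fun _ => (1 : ℝ≥0∞)) x =
      {t | ENNReal.ofReal t < u x}.indicator (fun _ => (1 : ℝ≥0∞)) t := fun t => rfl
  have hm : MeasurableSet {t | ENNReal.ofReal t < u x} :=
    measurableSet_lt (by fun_prop) measurable_const
  simp_rw [h1]
  rw [lintegral_indicator_const hm, one_mul, Measure.restrict_apply hm]
  rcases eq_or_ne (u x) ⊤ with h | h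
  · simp [h]
  · have : {t | ENNReal.ofReal t < u x} ∩ Set.Ioi 0 = Set.Ioo 0 (u x).toReal := by
      ext t
      simp only [Set.mem_inter_iff, Set.mem_ofPred_eq, Set.mem_Ioi, Set.mem_Ioo]
      rw [and_comm]
      exact and_congr_right fun ht => ENNReal.ofReal_lt_iff_lt_toReal ht.le h
    rw [this, Real.volume_Ioo, sub_zero, ENNReal.ofReal_toReal h]

variable {X : Type*} [MeasurableSpace X]

theorem measurable_lintegral_indicator {S : ℝ → Set X}
    (hS : MeasurableSet {z : X × ℝ | z.1 ∈ S z.2}) :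
    Measurable fun x => ∫⁻ t in Set.Ioi (0 : ℝ), (S t).indicator (fun _ => (1 : ℝ≥0∞)) x :=
  ((measurable_const (a := (1 : ℝ≥0∞))).indicator hS).lintegral_prod_right'

theorem lintegral_lintegral_indicator_mul (ν : Measure X) [SFinite ν] {S : ℝ → Set X}
    (hS : MeasurableSet {z : X × ℝ | z.1 ∈ S z.2}) {g : X → ℝ≥0∞} (hg : Measurable g) :
    ∫⁻ x, (∫⁻ t in Set.Ioi (0 : ℝ), (S t).indicator (fun _ => (1 : ℝ≥0∞)) x) * g x ∂ν =
      ∫⁻ t in Set.Ioi (0 : ℝ), ∫⁻ x in S t, g x ∂ν := by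
  have hF : Measurable fun z : X × ℝ => (S z.2).indicator (fun _ => (1 : ℝ≥0∞)) z.1 * g z.1 :=
    ((measurable_const (a := (1 : ℝ≥0∞))).indicator hS).mul (hg.comp measurable_fst)
  have h1 : ∀ x, (∫⁻ t in Set.Ioi (0 : ℝ), (S t).indicator (fun _ => (1 : ℝ≥0∞)) x) * g x =
      ∫⁻ t in Set.Ioi (0 : ℝ), (S t).indicator (fun _ => (1 : ℝ≥0∞)) x * g x := fun x =>
    (lintegral_mul_const _ (((measurable_const (a := (1 : ℝ≥0∞))).indicator hS).comp
      measurable_prodMk_left)).symm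
  simp_rw [h1]
  rw [lintegral_lintegral_swap hF.aemeasurable]
  refine lintegral_congr fun t => ?_
  have hSt : MeasurableSet (S t) := measurable_prodMk_right (y := t) hS
  rw [← lintegral_indicator hSt]
  refine lintegral_congr fun x => ?_
  by_cases hx : x ∈ S t <;> simp [hx]

theorem measurableSet_ofReal_lt {u : X → ℝ≥0∞} (hu : Measurable u) :
    MeasurableSet {z : X × ℝ | z.1 ∈ {y | ENNReal.ofReal z.2 < u y}} :=
  measurableSet_lt (by fun_prop) (hu.comp measurable_fst)

theorem lintegral_mul_eq_lintegral_superlevel (ν : Measure X) [SFinite ν] {u g : X → ℝ≥0∞}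
    (hu : Measurable u) (hg : Measurable g) :
    ∫⁻ x, u x * g x ∂ν =
      ∫⁻ t in Set.Ioi (0 : ℝ), ∫⁻ x in {x | ENNReal.ofReal t < u x}, g x ∂ν := by
  rw [← lintegral_lintegral_indicator_mul ν (measurableSet_ofReal_lt hu) hg]
  simp_rw [lintegral_indicator_ofReal_lt]

end LayerCake

section Bathtub

variable {E : Type*} [NormedAddCommGroup E] [InnerProductSpace ℝ E] [FiniteDimensional ℝ E]
  [MeasurableSpace E] [BorelSpace E] [Nontrivial E]

theorem exists_subset_volume_eq {Y : Set E} (hY : MeasurableSet Y) (hY' : volume Y ≠ ⊤)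
    {τ : ℝ≥0∞} (hτ : τ ≤ volume Y) : ∃ D ⊆ Y, MeasurableSet D ∧ volume D = τ := by
  rcases hτ.eq_or_lt with rfl | hτ
  · exact ⟨Y, subset_rfl, hY, rfl⟩
  have : IsFiniteMeasure (volume.restrict Y) := ⟨by simpa using hY'.lt_top⟩
  set ν := (volume.restrict Y).map (fun x : E => ‖x‖) with hν
  have hνs : ∀ s, MeasurableSet s → ν s = volume (Y ∩ (fun x : E => ‖x‖) ⁻¹' s) := by
    intro s hs
    rw [hν, Measure.map_apply measurable_norm hs, Measure.restrict_apply (measurable_norm hs),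
      Set.inter_comm]
  have : NullSingletonClass ν := by
    refine ⟨fun r => ?_⟩
    rw [hνs _ (measurableSet_singleton r)]
    refine measure_mono_null (fun x hx => ?_) (Measure.addHaar_sphere volume (0 : E) r)
    simpa using hx.2
  have hcont : Continuous fun b => ∫ _ in (-1)..b, (1 : ℝ) ∂ν :=
    intervalIntegral.continuous_primitive (fun a b => intervalIntegrable_const) (-1)
  have hF : ∀ b, -1 ≤ b → ∫ _ in (-1)..b, (1 : ℝ) ∂ν = ν.real (Set.Ioc (-1) b) := by
    intro b hb
    rw [intervalIntegral.integral_of_le hb]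
    simp
  have htop : Tendsto (fun n : ℕ => ν (Set.Ioc (-1) n)) atTop (𝓝 (volume Y)) := by
    have h := tendsto_measure_iUnion_atTop (μ := ν) (s := fun n : ℕ => Set.Ioc (-1 : ℝ) n)
      (fun m n h => Set.Ioc_subset_Ioc_right (by exact_mod_cast h))
    have hU : (⋃ n : ℕ, Set.Ioc (-1 : ℝ) n) = Set.Ioi (-1) := by
      ext x
      simp only [Set.mem_iUnion, Set.mem_Ioc, Set.mem_Ioi, exists_and_left]
      exact ⟨fun h => h.1, fun h => ⟨h, exists_nat_ge x⟩⟩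
    have hY1 : Y ∩ (fun x : E => ‖x‖) ⁻¹' Set.Ioi (-1) = Y := by
      refine Set.inter_eq_left.mpr fun x _ => ?_
      have := norm_nonneg x
      simp only [Set.mem_preimage, Set.mem_Ioi]
      linarith
    rwa [hU, hνs _ measurableSet_Ioi, hY1] at h
  obtain ⟨n, hn⟩ := (htop.eventually (lt_mem_nhds hτ)).exists
  have hτtop : τ ≠ ⊤ := ne_top_of_lt hτ
  obtain ⟨b, hb, hbτ⟩ := intermediate_value_Icc (show (-1 : ℝ) ≤ n by
    linarith [n.cast_nonneg (α := ℝ)]) hcont.continuousOn (show τ.toReal ∈ _ by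
      rw [intervalIntegral.integral_same, hF _ (by linarith [n.cast_nonneg (α := ℝ)])]
      exact ⟨ENNReal.toReal_nonneg, ENNReal.toReal_mono (measure_ne_top _ _) hn.le⟩)
  refine ⟨Y ∩ (fun x : E => ‖x‖) ⁻¹' Set.Ioc (-1) b, Set.inter_subset_left,
    hY.inter (measurable_norm measurableSet_Ioc), ?_⟩
  rw [← hνs _ measurableSet_Ioc]
  dsimp only at hbτ
  rw [hF b hb.1] at hbτ
  exact (ENNReal.toReal_eq_toReal_iff' (measure_ne_top _ _) hτtop).mp hbτ

/-- The bathtub principle: some set of measure at most `δ` captures the largest values of `p`. -/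
theorem exists_volume_le_min_le {p : E → ℝ≥0∞} (hp : Measurable p)
    (hp' : ∀ r, 0 < r → volume {x | r < p x} ≠ ⊤) (δ : ℝ≥0∞) (hδ : δ ≠ ⊤) :
    ∃ D, MeasurableSet D ∧ volume D ≤ δ ∧
      ∀ r, 0 < r → min (volume {x | r < p x}) δ ≤ volume (D ∩ {x | r < p x}) := by
  have hm : ∀ r, MeasurableSet {x | r < p x} := fun r => measurableSet_lt measurable_const hp
  have hanti : ∀ r s, r ≤ s → {x | s < p x} ⊆ {x | r < p x} := fun r s h x hx =>
    h.trans_lt hx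
  set q := sInf {r | volume {x | r < p x} ≤ δ} with hq
  have hgt : ∀ r, q < r → volume {x | r < p x} ≤ δ := by
    intro r hr
    obtain ⟨s, hs, hsr⟩ := sInf_lt_iff.mp hr
    exact (measure_mono (hanti s r hsr.le)).trans hs
  have hlt : ∀ r, r < q → δ ≤ volume {x | r < p x} := by
    intro r hr
    by_contra! h
    exact absurd (sInf_le h.le : q ≤ r) hr.not_ge
  have hqle : volume {x | q < p x} ≤ δ := by
    rcases eq_or_ne q ⊤ with hqt | hqt
    · simp [hqt]
    obtain ⟨u, hu, hu', hul⟩ := exists_seq_strictAnti_tendsto' hqt.lt_top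
    have hU : {x | q < p x} = ⋃ n, {x | u n < p x} := by
      ext x
      simp only [Set.mem_iUnion, Set.mem_ofPred_eq]
      refine ⟨fun hx => (hul.eventually (gt_mem_nhds hx)).exists, fun ⟨n, hn⟩ =>
        (hu' n).1.trans hn⟩
    rw [hU, Monotone.measure_iUnion fun m n h => hanti _ _ (hu.antitone h)]
    exact iSup_le fun n => hgt _ (hu' n).1
  rcases eq_or_ne q 0 with hq0 | hq0
  · refine ⟨{x | q < p x}, hm q, hqle, fun r _ => ?_⟩
    rw [Set.inter_eq_right.mpr (hanti q r (hq0 ▸ zero_le))]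
    exact min_le_left _ _
  have hXm : MeasurableSet {x | q ≤ p x} := measurableSet_le measurable_const hp
  have hWX : {x | q < p x} ⊆ {x | q ≤ p x} := fun x (hx : q < p x) => hx.le
  have hδX : δ ≤ volume {x | q ≤ p x} ∧ volume {x | q ≤ p x} ≠ ⊤ := by
    obtain ⟨u, hu, hu', hul⟩ := exists_seq_strictMono_tendsto' (pos_iff_ne_zero.mpr hq0)
    have hI : {x | q ≤ p x} = ⋂ n, {x | u n < p x} := by
      ext x
      simp only [Set.mem_iInter, Set.mem_ofPred_eq]
      exact ⟨fun hx n => (hu' n).2.trans_le hx, fun h => le_of_tendsto' hul fun n => (h n).le⟩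
    refine ⟨?_, ne_top_of_le_ne_top (hp' (u 0) (hu' 0).1)
      (measure_mono (hI ▸ Set.iInter_subset _ 0))⟩
    rw [hI, Antitone.measure_iInter (fun m n h => hanti _ _ (hu.monotone h))
      (fun n => (hm _).nullMeasurableSet) ⟨0, hp' _ (hu' 0).1⟩]
    exact le_iInf fun n => hlt _ (hu' n).2
  have hW : volume {x | q < p x} ≠ ⊤ := ne_top_of_le_ne_top hδ hqle
  have hsd : volume ({x | q ≤ p x} \ {x | q < p x}) =
      volume {x | q ≤ p x} - volume {x | q < p x} :=
    measure_sdiff hWX (hm q).nullMeasurableSet hW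
  obtain ⟨D, hD, hDm, hDv⟩ := exists_subset_volume_eq (hXm.diff (hm q))
    (ne_top_of_le_ne_top hδX.2 (measure_mono Set.sdiff_subset))
    (τ := δ - volume {x | q < p x}) (by rw [hsd]; exact tsub_le_tsub_right hδX.1 _)
  have hU : volume ({x | q < p x} ∪ D) = δ := by
    rw [measure_union (Set.disjoint_sdiff_right.mono_right hD) hDm, hDv,
      add_tsub_cancel_of_le hqle]
  refine ⟨{x | q < p x} ∪ D, (hm q).union hDm, hU.le, fun r _ => ?_⟩
  rcases lt_or_ge r q with hr | hr
  · rw [Set.inter_eq_left.mpr, hU]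
    · exact min_le_right _ _
    · rintro x (hx | hx)
      · exact hr.trans hx
      · exact hr.trans_le (hD hx).1
  · rw [Set.inter_eq_right.mpr ((hanti q r hr).trans Set.subset_union_left)]
    exact min_le_left _ _

end Bathtub

section Domination

variable {d : ℕ}

local notation "𝔼" => EuclideanSpace ℝ (Fin d)

/-- `h` is a radially nonincreasing function. -/
def RadiallyAntitone (h : 𝔼 → ℝ≥0∞) : Prop :=
  ∀ ⦃x y⦄, ‖x‖ ≤ ‖y‖ → h y ≤ h x

/-- `h` is radially nonincreasing and its integral over centered balls dominates the integral of `g`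
over arbitrary sets of the same finite measure. -/
structure IsDominatedBy (g h : 𝔼 → ℝ≥0∞) : Prop where
  measurable_left : Measurable g
  measurable_right : Measurable h
  radiallyAntitone : RadiallyAntitone h
  setLIntegral_le : ∀ A, MeasurableSet A → volume A ≠ ⊤ →
    ∫⁻ x in A, g x ≤ ∫⁻ x in ballStar A, h x

theorem isDominatedBy_const (hd : 1 ≤ d) (c : ℝ≥0∞) :
    IsDominatedBy (fun _ : 𝔼 => c) fun _ => c where
  measurable_left := measurable_const
  measurable_right := measurable_const
  radiallyAntitone := fun _ _ _ => le_rfl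
  setLIntegral_le A _ hA := by simp [volume_ballStar hd hA]

theorem measurableSet_mem_ballStar {U : ℝ → Set 𝔼} (hU : ∀ s t, s ≤ t → U t ⊆ U s) :
    MeasurableSet {z : 𝔼 × ℝ | z.1 ∈ ballStar (U z.2)} := by
  have h1 : Measurable fun t => volume (U t) :=
    Antitone.measurable fun s t h => measure_mono (hU s t h)
  have h2 : Measurable fun t => symmRadius (U t) :=
    (ENNReal.measurable_toReal.comp (h1.div_const _)).pow_const _
  simp only [ballStar, mem_ball_zero_iff]
  exact measurableSet_lt (by fun_prop) (h2.comp measurable_snd)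

theorem measurableSet_mem_ballStar_superlevel (f : 𝔼 → ℝ) :
    MeasurableSet {z : 𝔼 × ℝ | z.1 ∈ ballStar {y | z.2 < f y}} :=
  measurableSet_mem_ballStar (U := fun t => {y | t < f y}) fun _ _ h _ hx => h.trans_lt hx

theorem measurable_symmRearrange (f : 𝔼 → ℝ) : Measurable (symmRearrange f) :=
  measurable_lintegral_indicator (measurableSet_mem_ballStar_superlevel f)

theorem radiallyAntitone_symmRearrange (f : 𝔼 → ℝ) : RadiallyAntitone (symmRearrange f) := by
  intro x y h
  refine lintegral_mono fun t => ?_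
  by_cases hy : y ∈ ballStar {y | t < f y}
  · have hx : x ∈ ballStar {y | t < f y} := by
      rw [ballStar, mem_ball_zero_iff] at hy ⊢
      exact h.trans_lt hy
    rw [Set.indicator_of_mem hx, Set.indicator_of_mem hy]
  · rw [Set.indicator_of_notMem hy]
    exact zero_le

theorem lintegral_symmRearrange_mul (ν : Measure 𝔼) [SFinite ν] (f : 𝔼 → ℝ) {h : 𝔼 → ℝ≥0∞}
    (hh : Measurable h) :
    ∫⁻ x, symmRearrange f x * h x ∂ν =
      ∫⁻ t in Set.Ioi (0 : ℝ), ∫⁻ x in ballStar {y | t < f y}, h x ∂ν :=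
  lintegral_lintegral_indicator_mul ν (measurableSet_mem_ballStar_superlevel f) hh

theorem lintegral_ofReal_mul (ν : Measure 𝔼) [SFinite ν] {f : 𝔼 → ℝ} (hf : Measurable f)
    {g : 𝔼 → ℝ≥0∞} (hg : Measurable g) :
    ∫⁻ x, ENNReal.ofReal (f x) * g x ∂ν =
      ∫⁻ t in Set.Ioi (0 : ℝ), ∫⁻ x in {x | t < f x}, g x ∂ν := by
  rw [lintegral_mul_eq_lintegral_superlevel ν hf.ennreal_ofReal hg]
  refine setLIntegral_congr_fun measurableSet_Ioi fun t ht => ?_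
  simp_rw [ENNReal.ofReal_lt_ofReal_iff_of_nonneg (le_of_lt ht)]

theorem IsDominatedBy.ofReal_mul {f : 𝔼 → ℝ} (hf : Measurable f) (hfv : VanishesAtInfinity f)
    {g h : 𝔼 → ℝ≥0∞} (H : IsDominatedBy g h) :
    IsDominatedBy (fun x => ENNReal.ofReal (f x) * g x) fun x => symmRearrange f x * h x where
  measurable_left := hf.ennreal_ofReal.mul H.measurable_left
  measurable_right := (measurable_symmRearrange f).mul H.measurable_right
  radiallyAntitone _ _ hxy :=
    mul_le_mul' (radiallyAntitone_symmRearrange f hxy) (H.radiallyAntitone hxy)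
  setLIntegral_le A hA hA' := by
    rw [lintegral_ofReal_mul _ hf H.measurable_left,
      lintegral_symmRearrange_mul _ _ H.measurable_right]
    refine setLIntegral_mono' measurableSet_Ioi fun t ht => ?_
    have hm : MeasurableSet {x | t < f x} := measurableSet_lt measurable_const hf
    rw [Measure.restrict_restrict hm, Measure.restrict_restrict (measurableSet_ballStar _)]
    refine (H.setLIntegral_le _ (hm.inter hA)
      (measure_ne_top_of_subset Set.inter_subset_right hA')).trans ?_
    refine lintegral_mono_set (Set.subset_inter ?_ ?_)
    · exact ballStar_mono (measure_mono Set.inter_subset_left) (hfv t ht).ne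
    · exact ballStar_mono (measure_mono Set.inter_subset_right) hA'

theorem exists_conv_density (A : Set 𝔼) {B : Set 𝔼} (hB : MeasurableSet B) :
    ∃ p : 𝔼 → ℝ≥0∞, Measurable p ∧ ∀ g : 𝔼 → ℝ≥0∞, Measurable g →
      ∫⁻ x, p x * g x = ∫⁻ y in A, ∫⁻ z in B, g (y + z) := by
  have hm : Measurable fun z : 𝔼 × 𝔼 => B.indicator (fun _ => (1 : ℝ≥0∞)) (z.1 - z.2) :=
    (measurable_const.indicator hB).comp (measurable_fst.sub measurable_snd)
  refine ⟨fun x => ∫⁻ y in A, B.indicator (fun _ => (1 : ℝ≥0∞)) (x - y),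
    hm.lintegral_prod_right', fun g hg => ?_⟩
  have h1 : ∀ x, (∫⁻ y in A, B.indicator (fun _ => (1 : ℝ≥0∞)) (x - y)) * g x =
      ∫⁻ y in A, B.indicator (fun _ => (1 : ℝ≥0∞)) (x - y) * g x := fun x =>
    (lintegral_mul_const _ (hm.comp measurable_prodMk_left)).symm
  simp_rw [h1]
  rw [lintegral_lintegral_swap (hm.mul (hg.comp measurable_fst)).aemeasurable]
  refine lintegral_congr fun y => ?_
  rw [← lintegral_indicator hB, ← lintegral_add_left_eq_self _ y]
  refine lintegral_congr fun z => ?_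
  rw [add_sub_cancel_left]
  by_cases hz : z ∈ B <;> simp [hz]

theorem rieszForm_eq_lintegral {A B C : Set 𝔼} (hA : MeasurableSet A) (hB : MeasurableSet B)
    (hC : MeasurableSet C) :
    rieszForm A B C = ∫⁻ y in A, ∫⁻ z in B, C.indicator (fun _ => (1 : ℝ≥0∞)) (y + z) := by
  rw [rieszForm, Measure.prod_apply (measurableSet_sumTriples hA hB hC), ← lintegral_indicator hA]
  refine lintegral_congr fun y => ?_
  by_cases hy : y ∈ A
  · rw [Set.indicator_of_mem hy]
    have hm : MeasurableSet ((fun z => y + z) ⁻¹' C) := measurable_const_add y hC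
    have h1 : ∀ z, C.indicator (fun _ => (1 : ℝ≥0∞)) (y + z) =
        ((fun z => y + z) ⁻¹' C).indicator (fun _ => (1 : ℝ≥0∞)) z := fun z => rfl
    simp_rw [h1]
    rw [lintegral_indicator_const hm, one_mul, Measure.restrict_apply hm]
    congr 1
    ext z
    simp [sumTriples, hy, and_comm]
  · rw [Set.indicator_of_notMem hy]
    convert measure_empty (μ := (volume : Measure 𝔼))
    ext z
    simp [sumTriples, hy]

/-- The bathtub principle for the density of a convolution of two indicator functions, combined with
the Riesz inequality. -/
theorem lintegral_min_le_rieszForm (hd : 1 ≤ d) {A B H : Set 𝔼} (hA : MeasurableSet A)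
    (hB : MeasurableSet B) (hA' : volume A ≠ ⊤) (hB' : volume B ≠ ⊤) (hH : MeasurableSet H)
    (hHr : ∀ x ∈ H, ∀ y, ‖y‖ ≤ ‖x‖ → y ∈ H) {p : 𝔼 → ℝ≥0∞} (hp : Measurable p)
    (hpg : ∀ g : 𝔼 → ℝ≥0∞, Measurable g → ∫⁻ x, p x * g x = ∫⁻ y in A, ∫⁻ z in B, g (y + z))
    (hpf : ∀ r, 0 < r → volume {x | r < p x} ≠ ⊤) :
    ∫⁻ t in Set.Ioi (0 : ℝ), min (volume {x | ENNReal.ofReal t < p x}) (volume H) ≤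
      rieszForm (ballStar A) (ballStar B) H := by
  have hpD : ∀ D, MeasurableSet D → rieszForm A B D =
      ∫⁻ t in Set.Ioi (0 : ℝ), volume (D ∩ {x | ENNReal.ofReal t < p x}) := by
    intro D hD
    have hDm : Measurable (D.indicator fun _ => (1 : ℝ≥0∞)) := measurable_const.indicator hD
    rw [rieszForm_eq_lintegral hA hB hD, ← hpg _ hDm,
      lintegral_mul_eq_lintegral_superlevel _ hp hDm]
    refine lintegral_congr fun t => ?_
    rw [lintegral_indicator_const hD, one_mul, Measure.restrict_apply hD]
  rcases eq_or_ne (volume H) ⊤ with hHt | hHt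
  · have hHu : H = Set.univ := by
      refine Set.eq_univ_iff_forall.mpr fun x => ?_
      by_contra hx
      have hsub : H ⊆ Metric.ball 0 ‖x‖ := by
        intro y hy
        rw [mem_ball_zero_iff]
        by_contra! h
        exact hx (hHr y hy x h)
      exact measure_ne_top_of_subset hsub measure_ball_lt_top.ne hHt
    have h1 : rieszForm (ballStar A) (ballStar B) H = rieszForm A B Set.univ := by
      have h2 : ∀ X Y : Set 𝔼, rieszForm X Y Set.univ = volume X * volume Y := by
        intro X Y
        have : sumTriples X Y Set.univ = X ×ˢ Y := by
          ext z
          simp [sumTriples]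
        rw [rieszForm, this, Measure.prod_prod]
      rw [hHu, h2, h2, volume_ballStar hd hA', volume_ballStar hd hB']
    rw [h1, hpD _ MeasurableSet.univ]
    refine lintegral_mono fun t => ?_
    simp
  · have : Nonempty (Fin d) := ⟨⟨0, hd⟩⟩
    obtain ⟨D, hD, hDH, hmin⟩ := exists_volume_le_min_le hp hpf (volume H) hHt
    have hDt : volume D ≠ ⊤ := ne_top_of_le_ne_top hHt hDH
    calc ∫⁻ t in Set.Ioi (0 : ℝ), min (volume {x | ENNReal.ofReal t < p x}) (volume H)
        ≤ ∫⁻ t in Set.Ioi (0 : ℝ), volume (D ∩ {x | ENNReal.ofReal t < p x}) :=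
          setLIntegral_mono' measurableSet_Ioi fun t ht => hmin _ (ENNReal.ofReal_pos.mpr ht)
      _ = rieszForm A B D := (hpD D hD).symm
      _ ≤ rieszForm (ballStar A) (ballStar B) (ballStar D) :=
          rieszForm_le_ballStar hd hA hB hD hA' hB' hDt
      _ ≤ rieszForm (ballStar A) (ballStar B) H +
          volume (ballStar A) * volume (ballStar D \ H) :=
          rieszForm_le_add₃ _ (measurableSet_ballStar A) (measurableSet_ballStar D) hH
      _ = rieszForm (ballStar A) (ballStar B) H := by
          have h0 : volume (ballStar D \ H) = 0 := by
            by_cases h : ballStar D ⊆ H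
            · rw [Set.sdiff_eq_empty.mpr h, measure_empty]
            · obtain ⟨x, hx, hxH⟩ := Set.not_subset.mp h
              have hsub : H ⊆ ballStar D := by
                intro y hy
                rw [ballStar, mem_ball_zero_iff] at hx ⊢
                by_contra! hcon
                exact hxH (hHr y hy x (hx.le.trans hcon))
              rw [measure_sdiff hsub hH.nullMeasurableSet hHt, volume_ballStar hd hDt,
                tsub_eq_zero_of_le hDH]
          rw [h0, mul_zero, add_zero]

theorem IsDominatedBy.lintegral_lintegral_add_le (hd : 1 ≤ d) {g h : 𝔼 → ℝ≥0∞}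
    (H : IsDominatedBy g h) {A B : Set 𝔼} (hA : MeasurableSet A) (hB : MeasurableSet B)
    (hA' : volume A ≠ ⊤) (hB' : volume B ≠ ⊤) :
    ∫⁻ y in A, ∫⁻ z in B, g (y + z) ≤ ∫⁻ y in ballStar A, ∫⁻ z in ballStar B, h (y + z) := by
  obtain ⟨p, hp, hpg⟩ := exists_conv_density A hB
  obtain ⟨q, hq, hqg⟩ := exists_conv_density (ballStar A) (measurableSet_ballStar B)
  have hpint : ∫⁻ x, p x ≠ ⊤ := by
    have h1 := hpg (fun _ => 1) measurable_const
    simp only [mul_one, lintegral_const, one_mul, Measure.restrict_apply MeasurableSet.univ,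
      Set.univ_inter] at h1
    rw [h1]
    exact ENNReal.mul_ne_top hB' hA'
  have hpf : ∀ r, 0 < r → volume {x | r < p x} ≠ ⊤ := by
    intro r hr
    rcases eq_or_ne r ⊤ with rfl | hrt
    · simp
    refine ne_top_of_le_ne_top (ENNReal.div_ne_top hpint hr.ne')
      ((measure_mono fun x (hx : r < p x) => hx.le).trans
      (meas_ge_le_lintegral_div hp.aemeasurable hr.ne' hrt))
  have hpft : ∀ t : ℝ, t ∈ Set.Ioi 0 → volume {x | ENNReal.ofReal t < p x} ≠ ⊤ := fun t ht =>
    hpf _ (ENNReal.ofReal_pos.mpr ht)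
  have hpm : ∀ t : ℝ, MeasurableSet {x | ENNReal.ofReal t < p x} := fun t =>
    measurableSet_lt measurable_const hp
  have hhm : ∀ t : ℝ, MeasurableSet {x | ENNReal.ofReal t < h x} := fun t =>
    measurableSet_lt measurable_const H.measurable_right
  have hDm : MeasurableSet
      {z : 𝔼 × ℝ | z.1 ∈ (fun t => ballStar {x | ENNReal.ofReal t < p x}) z.2} :=
    measurableSet_mem_ballStar (U := fun t => {x | ENNReal.ofReal t < p x})
      fun s t hst x hx => (ENNReal.ofReal_le_ofReal hst).trans_lt hx
  calc ∫⁻ y in A, ∫⁻ z in B, g (y + z) = ∫⁻ x, p x * g x := (hpg g H.measurable_left).symm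
    _ = ∫⁻ t in Set.Ioi (0 : ℝ), ∫⁻ x in {x | ENNReal.ofReal t < p x}, g x :=
        lintegral_mul_eq_lintegral_superlevel _ hp H.measurable_left
    _ ≤ ∫⁻ t in Set.Ioi (0 : ℝ), ∫⁻ x in ballStar {x | ENNReal.ofReal t < p x}, h x :=
        setLIntegral_mono' measurableSet_Ioi fun t ht => H.setLIntegral_le _ (hpm t) (hpft t ht)
    _ = ∫⁻ x, h x * ∫⁻ t in Set.Ioi (0 : ℝ),
          (ballStar {x | ENNReal.ofReal t < p x}).indicator (fun _ => (1 : ℝ≥0∞)) x := by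
        rw [← lintegral_lintegral_indicator_mul _ hDm H.measurable_right]
        simp_rw [mul_comm]
    _ = ∫⁻ k in Set.Ioi (0 : ℝ), ∫⁻ x in {x | ENNReal.ofReal k < h x},
          ∫⁻ t in Set.Ioi (0 : ℝ),
          (ballStar {x | ENNReal.ofReal t < p x}).indicator (fun _ => (1 : ℝ≥0∞)) x :=
        lintegral_mul_eq_lintegral_superlevel _ H.measurable_right
          (measurable_lintegral_indicator hDm)
    _ = ∫⁻ k in Set.Ioi (0 : ℝ), ∫⁻ t in Set.Ioi (0 : ℝ),
          volume (ballStar {x | ENNReal.ofReal t < p x} ∩ {x | ENNReal.ofReal k < h x}) := by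
        refine lintegral_congr fun k => ?_
        have h1 := lintegral_lintegral_indicator_mul
          (volume.restrict {x | ENNReal.ofReal k < h x})
          (S := fun t => ballStar {x | ENNReal.ofReal t < p x}) hDm
          (measurable_const (a := (1 : ℝ≥0∞)))
        simp only [mul_one] at h1
        rw [h1]
        refine lintegral_congr fun t => ?_
        rw [setLIntegral_one, Measure.restrict_apply (measurableSet_ballStar _)]
    _ ≤ ∫⁻ k in Set.Ioi (0 : ℝ),
          rieszForm (ballStar A) (ballStar B) {x | ENNReal.ofReal k < h x} := by
        refine lintegral_mono fun k => ?_
        refine le_trans ?_ (lintegral_min_le_rieszForm hd hA hB hA' hB' (hhm k)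
          (fun x hx y hxy => lt_of_lt_of_le hx (H.radiallyAntitone hxy)) hp hpg hpf)
        refine setLIntegral_mono' measurableSet_Ioi fun t ht => le_min ?_ ?_
        · rw [← volume_ballStar hd (hpft t ht)]
          exact measure_mono Set.inter_subset_left
        · exact measure_mono Set.inter_subset_right
    _ = ∫⁻ k in Set.Ioi (0 : ℝ), ∫⁻ x in {x | ENNReal.ofReal k < h x}, q x := by
        refine lintegral_congr fun k => ?_
        rw [rieszForm_eq_lintegral (measurableSet_ballStar A) (measurableSet_ballStar B) (hhm k),
          ← hqg _ (measurable_const.indicator (hhm k)), ← lintegral_indicator (hhm k)]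
        refine lintegral_congr fun x => ?_
        by_cases hx : x ∈ {x | ENNReal.ofReal k < h x}
        · rw [Set.indicator_of_mem hx, Set.indicator_of_mem hx, mul_one]
        · rw [Set.indicator_of_notMem hx, Set.indicator_of_notMem hx, mul_zero]
    _ = ∫⁻ x, q x * h x := by
        rw [← lintegral_mul_eq_lintegral_superlevel _ H.measurable_right hq]
        simp_rw [mul_comm]
    _ = _ := hqg h H.measurable_right

end Domination

section Convolution

/-- The reflection exchanging `y` and `y'`: it moves points away from the origin when they are on
the side of `y`, and towards the origin otherwise. -/
theorem exists_measurePreserving_reflection {E : Type*} [NormedAddCommGroup E]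
    [InnerProductSpace ℝ E] [FiniteDimensional ℝ E] [MeasurableSpace E] [BorelSpace E] {y y' : E}
    (hne : y ≠ y') (hle : ‖y‖ ≤ ‖y'‖) :
    ∃ σ : E → E, MeasurePreserving σ ∧ ∀ z, ‖y - σ z‖ = ‖y' - z‖ ∧ ‖y' - σ z‖ = ‖y - z‖ ∧
      (‖y - z‖ ≤ ‖y' - z‖ → ‖z‖ ≤ ‖σ z‖) ∧ (‖y' - z‖ ≤ ‖y - z‖ → ‖σ z‖ ≤ ‖z‖) := by
  set w := y' - y with hw
  set m := (2⁻¹ : ℝ) • (y + y') with hm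
  have hw0 : ‖w‖ ^ 2 ≠ 0 := pow_ne_zero 2 (norm_ne_zero_iff.mpr (sub_ne_zero.mpr hne.symm))
  set R := (ℝ ∙ w)ᗮ.reflection with hR
  have hRw : R w = -w := Submodule.reflection_orthogonalComplement_singleton_eq_neg w
  have hy : y = m - (2⁻¹ : ℝ) • w := by rw [hm, hw]; module
  have hy' : y' = m + (2⁻¹ : ℝ) • w := by rw [hm, hw]; module
  have hwm : 0 ≤ ⟪w, m⟫ := by
    have h1 : ⟪w, m⟫ = 2⁻¹ * (‖y'‖ ^ 2 - ‖y‖ ^ 2) := by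
      rw [hw, hm, inner_smul_right, inner_add_right, inner_sub_left, inner_sub_left,
        real_inner_self_eq_norm_sq, real_inner_self_eq_norm_sq, real_inner_comm y y']
      ring
    have h2 : ‖y‖ ^ 2 ≤ ‖y'‖ ^ 2 := by gcongr
    rw [h1]
    linarith
  have hside : ∀ z, ‖y' - z‖ ^ 2 - ‖y - z‖ ^ 2 = -2 * ⟪w, z - m⟫ := by
    intro z
    have h1 : y' - z = (2⁻¹ : ℝ) • w - (z - m) := by rw [hy']; module
    have h2 : y - z = -((2⁻¹ : ℝ) • w + (z - m)) := by rw [hy]; module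
    rw [h1, h2, norm_neg, norm_sub_sq_real, norm_add_sq_real, inner_smul_left]
    simp
    ring
  have hnorm : ∀ z, ∃ s : ℝ, s * ‖w‖ ^ 2 = 2 * ⟪w, z - m⟫ ∧
      ‖R (z - m) + m‖ ^ 2 = ‖z‖ ^ 2 - 2 * s * ⟪w, m⟫ := by
    intro z
    refine ⟨2 * (⟪w, z - m⟫ / ‖w‖ ^ 2), by rw [mul_assoc, div_mul_cancel₀ _ hw0], ?_⟩
    set s := 2 * (⟪w, z - m⟫ / ‖w‖ ^ 2) with hs
    have hs' : s * ‖w‖ ^ 2 = 2 * ⟪w, z - m⟫ := by rw [hs, mul_assoc, div_mul_cancel₀ _ hw0]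
    have h1 : R (z - m) + m = z - s • w := by
      rw [hR, Submodule.reflection_orthogonal_apply, Submodule.reflection_singleton_apply]
      simp only [RCLike.ofReal_real_eq_id, id]
      rw [hs]
      module
    rw [inner_sub_right] at hs'
    rw [h1, norm_sub_sq_real, inner_smul_right, norm_smul, mul_pow, Real.norm_eq_abs, sq_abs,
      real_inner_comm]
    linear_combination s * hs'
  refine ⟨fun z => R (z - m) + m, ?_, fun z => ⟨?_, ?_, fun h => ?_, fun h => ?_⟩⟩
  · exact (measurePreserving_add_right volume m).comp
      (R.measurePreserving.comp (measurePreserving_sub_right volume m))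
  · have h1 : y - (R (z - m) + m) = R (y' - z) := by
      have h2 : y' - z = (2⁻¹ : ℝ) • w - (z - m) := by rw [hy']; module
      have h3 : R ((2⁻¹ : ℝ) • w - (z - m)) = -((2⁻¹ : ℝ) • w) - R (z - m) := by
        rw [map_sub, map_smul, hRw, smul_neg]
      rw [h2, h3]
      generalize R (z - m) = q
      rw [hm, hw]
      module
    rw [h1, R.norm_map]
  · have h1 : y' - (R (z - m) + m) = R (y - z) := by
      have h2 : y - z = -((2⁻¹ : ℝ) • w) - (z - m) := by rw [hy]; module
      have h3 : R (-((2⁻¹ : ℝ) • w) - (z - m)) = (2⁻¹ : ℝ) • w - R (z - m) := by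
        rw [map_sub, map_neg, map_smul, hRw, smul_neg, neg_neg]
      rw [h2, h3]
      generalize R (z - m) = q
      rw [hm, hw]
      module
    rw [h1, R.norm_map]
  · obtain ⟨s, hs, hn⟩ := hnorm z
    have h1 : ‖y - z‖ ^ 2 ≤ ‖y' - z‖ ^ 2 := by gcongr
    have hs0 : s ≤ 0 := by
      have := hside z
      by_contra! hcon
      have : 0 < s * ‖w‖ ^ 2 := by positivity
      linarith
    rw [← sq_le_sq₀ (norm_nonneg _) (norm_nonneg _), hn]
    nlinarith
  · obtain ⟨s, hs, hn⟩ := hnorm z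
    have h1 : ‖y' - z‖ ^ 2 ≤ ‖y - z‖ ^ 2 := by gcongr
    have hs0 : 0 ≤ s := by
      have := hside z
      by_contra! hcon
      have : s * ‖w‖ ^ 2 < 0 := mul_neg_of_neg_of_pos hcon (by positivity)
      linarith
    rw [← sq_le_sq₀ (norm_nonneg _) (norm_nonneg _), hn]
    nlinarith

theorem ENNReal.mul_add_mul_le_mul_add_mul_of_le {a b p q : ℝ≥0∞} (hab : b ≤ a) (hpq : q ≤ p) :
    a * q + b * p ≤ a * p + b * q := by
  obtain ⟨e, rfl⟩ := exists_add_of_le hab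
  obtain ⟨f, rfl⟩ := exists_add_of_le hpq
  calc (b + e) * q + b * (q + f) ≤ (b + e) * q + b * (q + f) + e * f := le_self_add
    _ = _ := by ring

variable {d : ℕ}

local notation "𝔼" => EuclideanSpace ℝ (Fin d)

theorem RadiallyAntitone.lintegral_mul_add {u h : 𝔼 → ℝ≥0∞} (hu : RadiallyAntitone u)
    (hh : RadiallyAntitone h) (hum : Measurable u) (hhm : Measurable h) :
    RadiallyAntitone fun y => ∫⁻ z, u z * h (y + z) := by
  intro y y' hle
  rcases eq_or_ne y y' with rfl | hne
  · exact le_rfl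
  obtain ⟨σ, hσ, hσn⟩ := exists_measurePreserving_reflection hne hle
  have heven : ∀ v : 𝔼, ∫⁻ z, u z * h (v + z) = ∫⁻ z, u z * h (v - z) := by
    intro v
    rw [← lintegral_neg_eq_self]
    refine lintegral_congr fun z => ?_
    rw [le_antisymm (hu (x := z) (y := -z) (norm_neg z).ge) (hu (norm_neg z).le), sub_eq_add_neg]
  have hdouble : ∀ v : 𝔼, 2 * ∫⁻ z, u z * h (v - z) =
      ∫⁻ z, (u z * h (v - z) + u (σ z) * h (v - σ z)) := by
    intro v
    have hm : Measurable fun z => u z * h (v - z) := by fun_prop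
    rw [lintegral_add_left hm, hσ.lintegral_comp hm, two_mul]
  have hrad : ∀ {x x' : 𝔼}, ‖x‖ = ‖x'‖ → h x = h x' := fun hx =>
    le_antisymm (hh hx.ge) (hh hx.le)
  dsimp only
  rw [heven, heven, ← ENNReal.mul_le_mul_iff_right two_ne_zero ENNReal.ofNat_ne_top, hdouble,
    hdouble]
  refine lintegral_mono fun z => ?_
  obtain ⟨h1, h2, h3, h4⟩ := hσn z
  rw [hrad h1, hrad h2]
  rcases le_total ‖y - z‖ ‖y' - z‖ with hz | hz
  · exact ENNReal.mul_add_mul_le_mul_add_mul_of_le (hu (h3 hz)) (hh hz)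
  · rw [add_comm, add_comm (u z * h (y - z))]
    exact ENNReal.mul_add_mul_le_mul_add_mul_of_le (hu (h4 hz)) (hh hz)

theorem IsDominatedBy.conv (hd : 1 ≤ d) {φ : 𝔼 → ℝ} (hφ : Measurable φ)
    (hφv : VanishesAtInfinity φ) {g h : 𝔼 → ℝ≥0∞} (H : IsDominatedBy g h) :
    IsDominatedBy (fun y => ∫⁻ z, ENNReal.ofReal (φ z) * g (y + z))
      fun y => ∫⁻ z, symmRearrange φ z * h (y + z) where
  measurable_left := ((hφ.ennreal_ofReal.comp measurable_snd).mul
    (H.measurable_left.comp measurable_add)).lintegral_prod_right'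
  measurable_right := (((measurable_symmRearrange φ).comp measurable_snd).mul
    (H.measurable_right.comp measurable_add)).lintegral_prod_right'
  radiallyAntitone := (radiallyAntitone_symmRearrange φ).lintegral_mul_add H.radiallyAntitone
    (measurable_symmRearrange φ) H.measurable_right
  setLIntegral_le A hA hA' := by
    have hswap : ∀ (u v : 𝔼 → ℝ≥0∞) (S : Set 𝔼), Measurable u → Measurable v →
        ∫⁻ y in S, ∫⁻ z, u z * v (y + z) = ∫⁻ z, u z * ∫⁻ y in S, v (z + y) := by
      intro u v S hu hv
      rw [lintegral_lintegral_swap (by fun_prop)]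
      refine lintegral_congr fun z => ?_
      rw [lintegral_const_mul _ (by fun_prop)]
      simp_rw [add_comm]
    have hinner : ∀ (v : 𝔼 → ℝ≥0∞) (S : Set 𝔼), Measurable v →
        Measurable fun z => ∫⁻ y in S, v (z + y) := fun v S hv =>
      (hv.comp measurable_add).lintegral_prod_right'
    rw [hswap _ _ _ hφ.ennreal_ofReal H.measurable_left,
      hswap _ _ _ (measurable_symmRearrange φ) H.measurable_right,
      lintegral_ofReal_mul _ hφ (hinner _ _ H.measurable_left),
      lintegral_symmRearrange_mul _ _ (hinner _ _ H.measurable_right)]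
    exact setLIntegral_mono' measurableSet_Ioi fun t ht =>
      H.lintegral_lintegral_add_le hd (measurableSet_lt measurable_const hφ) hA (hφv t ht).ne hA'

theorem IsDominatedBy.lintegral_mul_add_le {φ : 𝔼 → ℝ} (hφ : Measurable φ)
    (hφv : VanishesAtInfinity φ) {g h : 𝔼 → ℝ≥0∞} (H : IsDominatedBy g h) (x : 𝔼) :
    ∫⁻ z, ENNReal.ofReal (φ z) * g (x + z) ≤ ∫⁻ z, symmRearrange φ z * h z := by
  rw [lintegral_ofReal_mul _ hφ (g := fun z => g (x + z))
      (H.measurable_left.comp (measurable_const_add x)),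
    lintegral_symmRearrange_mul _ _ H.measurable_right]
  refine setLIntegral_mono' measurableSet_Ioi fun t ht => ?_
  have hm : MeasurableSet {x | t < φ x} := measurableSet_lt measurable_const hφ
  have hmx : MeasurableSet ((fun z => -x + z) ⁻¹' {z | t < φ z}) := measurable_const_add _ hm
  have hvol : volume ((fun z => -x + z) ⁻¹' {z | t < φ z}) = volume {z | t < φ z} :=
    measure_preimage_add volume (-x) _
  have hstar : ballStar ((fun z => -x + z) ⁻¹' {z | t < φ z}) = ballStar {z | t < φ z} := by
    rw [ballStar, ballStar, symmRadius, symmRadius, hvol]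
  have htrans : ∫⁻ z in {z | t < φ z}, g (x + z) =
      ∫⁻ z in (fun z => -x + z) ⁻¹' {z | t < φ z}, g z := by
    rw [← lintegral_indicator hm, ← lintegral_indicator hmx,
      ← lintegral_add_left_eq_self (Set.indicator ((fun z => -x + z) ⁻¹' {z | t < φ z}) _) x]
    refine lintegral_congr fun z => ?_
    simp [Set.indicator]
  rw [htrans, ← hstar]
  exact H.setLIntegral_le _ hmx (hvol ▸ (hφv t ht).ne)

theorem ofReal_le_symmRearrange_zero (hd : 1 ≤ d) {f : 𝔼 → ℝ} (hf : Continuous f)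
    (hfv : VanishesAtInfinity f) (x : 𝔼) : ENNReal.ofReal (f x) ≤ symmRearrange f 0 := by
  rw [← lintegral_indicator_ofReal_lt (fun x => ENNReal.ofReal (f x)) x, symmRearrange]
  refine setLIntegral_mono' measurableSet_Ioi fun t ht => ?_
  by_cases hx : x ∈ {y | ENNReal.ofReal t < ENNReal.ofReal (f y)}
  · have hx' : t < f x := (ENNReal.ofReal_lt_ofReal_iff_of_nonneg (le_of_lt ht)).mp hx
    have hpos : volume (ballStar {y | t < f y}) ≠ 0 := by
      rw [volume_ballStar hd (hfv t ht).ne]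
      exact ((isOpen_lt continuous_const hf).measure_pos _ ⟨x, hx'⟩).ne'
    obtain ⟨z, hz⟩ := nonempty_of_measure_ne_zero hpos
    rw [Set.indicator_of_mem hx, Set.indicator_of_mem]
    rw [ballStar, mem_ball_zero_iff] at hz ⊢
    rw [norm_zero]
    exact (norm_nonneg z).trans_lt hz
  · rw [Set.indicator_of_notMem hx]
    exact zero_le

end Convolution

section Chain

variable {d : ℕ}

local notation "𝔼" => EuclideanSpace ℝ (Fin d)

/-- The iterated integral of `F 0 x * F 1 (x + x₁) * ⋯ * F K (x + x₁ + ⋯ + x_K)` against the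
product of the weights `φ (x_j)`, integrating one variable at a time. -/
noncomputable def walkChain (φ : 𝔼 → ℝ≥0∞) : ℕ → (ℕ → 𝔼 → ℝ≥0∞) → 𝔼 → ℝ≥0∞
  | 0, F => F 0
  | K + 1, F => fun x => F 0 x * ∫⁻ z, φ z * walkChain φ K (fun n => F (n + 1)) (x + z)

theorem measurable_partialSum {K : ℕ} (n : ℕ) :
    Measurable fun x : Fin K → 𝔼 => partialSum x n := by
  unfold partialSum
  refine Finset.measurable_sum _ fun j _ => ?_
  split_ifs <;> fun_prop

theorem partialSum_zero {K : ℕ} (x : Fin K → 𝔼) : partialSum x 0 = 0 := by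
  simp [partialSum]

theorem partialSum_cons_succ {K : ℕ} (z : 𝔼) (x : Fin K → 𝔼) (n : ℕ) :
    partialSum (Fin.cons z x : Fin (K + 1) → 𝔼) (n + 1) = z + partialSum x n := by
  simp [partialSum, Fin.sum_univ_succ]

theorem lintegral_fin_succ {K : ℕ} {G : (Fin (K + 1) → 𝔼) → ℝ≥0∞} (hG : Measurable G) :
    ∫⁻ x, G x = ∫⁻ z, ∫⁻ x : Fin K → 𝔼, G (Fin.cons z x) := by
  have h := (volume_preserving_piFinSuccAbove (fun _ : Fin (K + 1) => 𝔼) 0).symm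
  rw [← h.lintegral_comp hG, Measure.volume_eq_prod, lintegral_prod]
  · simp only [MeasurableEquiv.piFinSuccAbove_symm_apply, Fin.insertNthEquiv_zero]
    rfl
  · exact (hG.comp (MeasurableEquiv.measurable _)).aemeasurable

theorem lintegral_prod_partialSum_eq_walkChain {φ : 𝔼 → ℝ≥0∞} (hφ : Measurable φ) (K : ℕ)
    {F : ℕ → 𝔼 → ℝ≥0∞} (hF : ∀ n, Measurable (F n)) (x₀ : 𝔼) :
    ∫⁻ x : Fin K → 𝔼, (∏ n ∈ Finset.range (K + 1), F n (x₀ + partialSum x n)) * ∏ j, φ (x j) =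
      walkChain φ K F x₀ := by
  induction K generalizing F x₀ with
  | zero =>
    rw [lintegral_unique]
    simp [partialSum_zero, walkChain, volume_pi]
  | succ K ih =>
    have hm : ∀ {L : ℕ} {F : ℕ → 𝔼 → ℝ≥0∞} (_ : ∀ n, Measurable (F n)) (x₀ : 𝔼) (N : ℕ),
        Measurable fun x : Fin L → 𝔼 =>
          (∏ n ∈ Finset.range N, F n (x₀ + partialSum x n)) * ∏ j, φ (x j) := by
      intro L F hF x₀ N
      refine (Finset.measurable_fun_prod _ fun n _ => ?_).mul
        (Finset.measurable_fun_prod _ fun j _ => by fun_prop)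
      exact (hF n).comp ((measurable_partialSum n).const_add x₀)
    rw [lintegral_fin_succ (hm hF x₀ _), walkChain]
    have hsplit : ∀ (z : 𝔼) (x : Fin K → 𝔼),
        (∏ n ∈ Finset.range (K + 1 + 1),
            F n (x₀ + partialSum (Fin.cons z x : Fin (K + 1) → 𝔼) n)) *
          ∏ j, φ ((Fin.cons z x : Fin (K + 1) → 𝔼) j) =
        F 0 x₀ * φ z * ((∏ n ∈ Finset.range (K + 1), F (n + 1) (x₀ + z + partialSum x n)) *
          ∏ j, φ (x j)) := by
      intro z x
      rw [Finset.prod_range_succ', Fin.prod_univ_succ, partialSum_zero, add_zero]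
      simp only [partialSum_cons_succ, Fin.cons_zero, Fin.cons_succ, ← add_assoc]
      ring
    simp_rw [hsplit]
    have hinner : ∀ z, ∫⁻ x : Fin K → 𝔼, F 0 x₀ * φ z *
        ((∏ n ∈ Finset.range (K + 1), F (n + 1) (x₀ + z + partialSum x n)) * ∏ j, φ (x j)) =
        F 0 x₀ * (φ z * walkChain φ K (fun n => F (n + 1)) (x₀ + z)) := by
      intro z
      rw [lintegral_const_mul _ (hm (fun n => hF (n + 1)) _ _), ih (fun n => hF (n + 1)), mul_assoc]
    simp_rw [hinner]
    rw [lintegral_const_mul]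
    simp_rw [← ih (fun n => hF (n + 1))]
    refine hφ.mul (Measurable.lintegral_prod_right' (f := fun p : 𝔼 × (Fin K → 𝔼) =>
      (∏ n ∈ Finset.range (K + 1), F (n + 1) (x₀ + p.1 + partialSum p.2 n)) * ∏ j, φ (p.2 j)) ?_)
    refine (Finset.measurable_fun_prod _ fun n _ => ?_).mul
      (Finset.measurable_fun_prod _ fun j _ => by fun_prop)
    exact (hF (n + 1)).comp ((measurable_fst.const_add x₀).add
      ((measurable_partialSum n).comp measurable_snd))

/-- The product of those `u i x` whose time `k i` equals `n`. -/
noncomputable def prodAt {m : ℕ} (u : Fin m → 𝔼 → ℝ≥0∞) (k : Fin m → ℕ) (n : ℕ) (x : 𝔼) : ℝ≥0∞ :=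
  ∏ i with k i = n, u i x

theorem measurable_prodAt {m : ℕ} {u : Fin m → 𝔼 → ℝ≥0∞} (hu : ∀ i, Measurable (u i))
    (k : Fin m → ℕ) (n : ℕ) : Measurable (prodAt u k n) :=
  Finset.measurable_fun_prod _ fun i _ => hu i

theorem prod_prodAt {m : ℕ} (u : Fin m → 𝔼 → ℝ≥0∞) (k : Fin m → ℕ) (X : ℕ → 𝔼) :
    ∏ n ∈ Finset.range (Finset.univ.sup k + 1), prodAt u k n (X n) = ∏ i, u i (X (k i)) := by
  rw [← Finset.prod_fiberwise_of_maps_to (g := k) (t := Finset.range (Finset.univ.sup k + 1))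
    fun i _ => Finset.mem_range_succ_iff.mpr (Finset.le_sup (Finset.mem_univ i))]
  refine Finset.prod_congr rfl fun n _ => Finset.prod_congr rfl fun i hi => ?_
  rw [(Finset.mem_filter.mp hi).2]

theorem lintegral_prod_eq_walkChain {m : ℕ} {u : Fin m → 𝔼 → ℝ≥0∞} (hu : ∀ i, Measurable (u i))
    {φ : 𝔼 → ℝ≥0∞} (hφ : Measurable φ) (k : Fin m → ℕ) (x₀ : 𝔼) :
    ∫⁻ x : Fin (Finset.univ.sup k) → 𝔼, (∏ i, u i (x₀ + partialSum x (k i))) * ∏ j, φ (x j) =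
      walkChain φ (Finset.univ.sup k) (prodAt u k) x₀ := by
  rw [← lintegral_prod_partialSum_eq_walkChain hφ _ (measurable_prodAt hu k)]
  refine lintegral_congr fun x => ?_
  rw [prod_prodAt u k fun n => x₀ + partialSum x n]

theorem IsDominatedBy.prod_ofReal_mul {ι : Type*} {f : ι → 𝔼 → ℝ} (hf : ∀ i, Measurable (f i))
    (hfv : ∀ i, VanishesAtInfinity (f i)) {g h : 𝔼 → ℝ≥0∞} (H : IsDominatedBy g h)
    (s : Finset ι) :
    IsDominatedBy (fun x => (∏ i ∈ s, ENNReal.ofReal (f i x)) * g x)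
      fun x => (∏ i ∈ s, symmRearrange (f i) x) * h x := by
  classical
  induction s using Finset.induction_on with
  | empty => simpa using H
  | insert i s hi ih =>
    simp only [Finset.prod_insert hi, mul_assoc]
    exact ih.ofReal_mul (hf i) (hfv i)

theorem isDominatedBy_walkChain (hd : 1 ≤ d) {φ : 𝔼 → ℝ} (hφ : Measurable φ)
    (hφv : VanishesAtInfinity φ) (K : ℕ) {F G : ℕ → 𝔼 → ℝ≥0∞}
    (hFG : ∀ n g h, IsDominatedBy g h → IsDominatedBy (fun x => F n x * g x) fun x => G n x * h x) :
    IsDominatedBy (walkChain (fun z => ENNReal.ofReal (φ z)) K F)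
      (walkChain (symmRearrange φ) K G) := by
  induction K generalizing F G with
  | zero => simpa only [walkChain, mul_one] using hFG 0 _ _ (isDominatedBy_const hd 1)
  | succ K ih => exact hFG 0 _ _ ((ih fun n => hFG (n + 1)).conv hd hφ hφv)

theorem walkIntegral_le_walkIntegralStar {m : ℕ} {f : Fin m → 𝔼 → ℝ} {φ : 𝔼 → ℝ} (hd : 1 ≤ d)
    (hφ : Measurable φ) (hφv : VanishesAtInfinity φ) (hf : ∀ i, Continuous (f i))
    (hfv : ∀ i, VanishesAtInfinity (f i)) (x₀ : 𝔼) (k : Fin m → ℕ) :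
    walkIntegral f φ x₀ k ≤ walkIntegralStar f φ k := by
  have hleft : walkIntegral f φ x₀ k = walkChain (fun z => ENNReal.ofReal (φ z))
      (Finset.univ.sup k) (prodAt (fun i x => ENNReal.ofReal (f i x)) k) x₀ :=
    lintegral_prod_eq_walkChain (fun i => (hf i).measurable.ennreal_ofReal) hφ.ennreal_ofReal k x₀
  have hright : walkIntegralStar f φ k = walkChain (symmRearrange φ)
      (Finset.univ.sup k) (prodAt (fun i => symmRearrange (f i)) k) 0 := by
    rw [← lintegral_prod_eq_walkChain (fun i => measurable_symmRearrange (f i))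
      (measurable_symmRearrange φ) k 0]
    simp only [zero_add]
    rfl
  have hdom : ∀ n g h, IsDominatedBy g h →
      IsDominatedBy (fun x => prodAt (fun i x => ENNReal.ofReal (f i x)) k n x * g x)
        fun x => prodAt (fun i => symmRearrange (f i)) k n x * h x := fun n g h H =>
    H.prod_ofReal_mul (fun i => (hf i).measurable) hfv _
  have hzero : ∀ n, prodAt (fun i x => ENNReal.ofReal (f i x)) k n x₀ ≤
      prodAt (fun i => symmRearrange (f i)) k n 0 := fun n =>
    Finset.prod_le_prod' fun i _ => ofReal_le_symmRearrange_zero hd (hf i) (hfv i) x₀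
  rw [hleft, hright]
  cases Finset.univ.sup k with
  | zero => exact hzero 0
  | succ K =>
    refine mul_le_mul' (hzero 0) ?_
    simp only [zero_add]
    exact (isDominatedBy_walkChain hd hφ hφv K fun n => hdom (n + 1)).lintegral_mul_add_le hφ hφv x₀

end Chain

/-- **Rearrangement inequality for compound Poisson processes.**  The sum over all chains
`0 = k₀ ≤ k₁ ≤ ⋯ ≤ k_m` is parametrized bijectively by the increments
`j : Fin m → ℕ`, `j i = k_{i+1} - k_i`, so that `k_i = ∑_{l ≤ i} j l`. -/
theorem compound_poisson_rearrangement {d m : ℕ} (hd : 1 ≤ d) (hm : 1 ≤ m)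
    (φ : EuclideanSpace ℝ (Fin d) → ℝ) (hφ_meas : Measurable φ)
    (hφ_nonneg : ∀ y, 0 ≤ φ y)
    (hφ_prob : ∫⁻ y, ENNReal.ofReal (φ y) = 1)
    (hφ_van : VanishesAtInfinity φ)
    (f : Fin m → EuclideanSpace ℝ (Fin d) → ℝ)
    (hf_cont : ∀ i, Continuous (f i))
    (hf_nonneg : ∀ i x, 0 ≤ f i x)
    (hf_van : ∀ i, VanishesAtInfinity (f i))
    (c : ℝ) (hc : 0 < c)
    (t : ℕ → ℝ) (ht0 : t 0 = 0) (ht_mono : ∀ i, i < m → t i ≤ t (i + 1))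
    (x₀ : EuclideanSpace ℝ (Fin d)) :
    (∑' j : Fin m → ℕ,
        poissonWeight c t m j *
          walkIntegral f φ x₀ (fun i => ∑ l ∈ Finset.Iic i, j l)) ≤
      ∑' j : Fin m → ℕ,
        poissonWeight c t m j *
          walkIntegralStar f φ (fun i => ∑ l ∈ Finset.Iic i, j l) := by
  exact ENNReal.tsum_le_tsum fun j => mul_le_mul_right
    (walkIntegral_le_walkIntegralStar hd hφ_meas hφ_van hf_cont hf_van x₀ _) _
end

section
/- Symmetrization preserves continuity: Let f : ℝ^d → [0,∞) be a bounded continuous function vanishing at infinity. Then its symmetric decreasing rearrangement f* is continuous on ℝ^d. -/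
open MeasureTheory ENNReal Filter Topology
open scoped RealInnerProductSpace

theorem symmRadius_of_volume_eq_zero {d : ℕ} (hd : 1 ≤ d) {A : Set (EuclideanSpace ℝ (Fin d))}
    (hA : volume A = 0) : symmRadius A = 0 := by
  have hd' : (d : ℝ) ≠ 0 := by positivity
  simp [symmRadius, hA, Real.zero_rpow (inv_ne_zero hd')]

theorem volume_eq_of_symmRadius_eq {d : ℕ} (hd : 1 ≤ d) {A B : Set (EuclideanSpace ℝ (Fin d))}
    (hA : volume A < ⊤) (hB : volume B < ⊤) (h : symmRadius A = symmRadius B) :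
    volume A = volume B := by
  have hball : volume (Metric.ball (0 : EuclideanSpace ℝ (Fin d)) 1) ≠ 0 :=
    (Metric.measure_ball_pos volume 0 one_pos).ne'
  have hball' : volume (Metric.ball (0 : EuclideanSpace ℝ (Fin d)) 1) ≠ ⊤ :=
    measure_ball_lt_top.ne
  have hd' : (1 : ℝ) / d ≠ 0 := by positivity
  have h1 := (Real.rpow_left_inj ENNReal.toReal_nonneg ENNReal.toReal_nonneg hd').1 h
  have h2 := (ENNReal.toReal_eq_toReal_iff' (ENNReal.div_lt_top hA.ne hball).ne
    (ENNReal.div_lt_top hB.ne hball).ne).1 h1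
  rw [← ENNReal.div_mul_cancel (b := volume A) hball hball', h2,
    ENNReal.div_mul_cancel hball hball']

theorem VanishesAtInfinity.exists_le {d : ℕ} (hd : 1 ≤ d) {f : EuclideanSpace ℝ (Fin d) → ℝ}
    (hf : VanishesAtInfinity f) {s : ℝ} (hs : 0 < s) : ∃ z, f z ≤ s := by
  by_contra! h
  have : Nonempty (Fin d) := ⟨⟨0, hd⟩⟩
  have hlt := hf s hs
  rw [Set.eq_univ_of_forall (s := {x | s < f x}) h, measure_univ_of_isAddLeftInvariant] at hlt
  exact lt_irrefl _ hlt

/-- The superlevel sets of a continuous function vanishing at infinity strictly lose volume as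
the level increases, as long as they are nonempty. -/
theorem volume_superlevel_lt {d : ℕ} (hd : 1 ≤ d) {f : EuclideanSpace ℝ (Fin d) → ℝ}
    (hc : Continuous f) (hf : VanishesAtInfinity f) {s t : ℝ} (hs : 0 < s) (hst : s < t)
    {y : EuclideanSpace ℝ (Fin d)} (hy : t < f y) :
    volume {x | t < f x} < volume {x | s < f x} := by
  obtain ⟨z, hz⟩ := hf.exists_le hd hs
  obtain ⟨w, hw⟩ := mem_range_of_exists_le_of_exists_ge hc (c := (s + t) / 2)
    ⟨z, by linarith⟩ ⟨y, by linarith⟩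
  have hopen : IsOpen (f ⁻¹' Set.Ioo s t) := isOpen_Ioo.preimage hc
  have hpos : 0 < volume (f ⁻¹' Set.Ioo s t) :=
    hopen.measure_pos volume ⟨w, by rw [Set.mem_preimage, hw]; constructor <;> linarith⟩
  have hdisj : Disjoint {x | t < f x} (f ⁻¹' Set.Ioo s t) :=
    Set.disjoint_left.2 fun x hx hx' => lt_asymm hx hx'.2
  calc volume {x | t < f x}
      < volume {x | t < f x} + volume (f ⁻¹' Set.Ioo s t) :=
        ENNReal.lt_add_right (hf t (hs.trans hst)).ne hpos.ne'
    _ = volume ({x | t < f x} ∪ f ⁻¹' Set.Ioo s t) :=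
        (measure_union hdisj hopen.measurableSet).symm
    _ ≤ volume {x | s < f x} :=
        measure_mono (Set.union_subset (fun x hx => hst.trans hx) fun x hx => hx.1)

theorem measurable_symmRadius_superlevel {d : ℕ} (f : EuclideanSpace ℝ (Fin d) → ℝ) :
    Measurable fun t : ℝ => symmRadius {y | t < f y} := by
  have hanti : Antitone fun t : ℝ => volume {y | t < f y} := fun _ _ hst =>
    measure_mono fun _ hx => lt_of_le_of_lt hst hx
  exact (hanti.measurable.div_const _).ennreal_toReal.pow_const _

theorem ae_symmRadius_superlevel_ne {d : ℕ} (hd : 1 ≤ d) {f : EuclideanSpace ℝ (Fin d) → ℝ}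
    (hc : Continuous f) (hf : VanishesAtInfinity f) {r : ℝ} (hr : r ≠ 0) :
    ∀ᵐ t ∂(volume.restrict (Set.Ioi (0 : ℝ))), symmRadius {y | t < f y} ≠ r := by
  rw [ae_restrict_iff' measurableSet_Ioi]
  have key : ∀ s t : ℝ, 0 < s → s < t → symmRadius {y | s < f y} = r →
      symmRadius {y | t < f y} = r → False := by
    intro s t hs hst h1 h2
    have ht := hs.trans hst
    have hne : {y | t < f y}.Nonempty := by
      by_contra h
      rw [Set.not_nonempty_iff_eq_empty] at h
      exact hr (h2 ▸ symmRadius_of_volume_eq_zero hd (by rw [h, measure_empty]))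
    obtain ⟨y, hy⟩ := hne
    exact (volume_superlevel_lt hd hc hf hs hst hy).ne
      (volume_eq_of_symmRadius_eq hd (hf t ht) (hf s hs) (h2.trans h1.symm))
  have hsub : {t : ℝ | 0 < t ∧ symmRadius {y | t < f y} = r}.Subsingleton := by
    intro s hs t ht
    rcases lt_trichotomy s t with h | h | h
    · exact (key s t hs.1 h hs.2 ht.2).elim
    · exact h
    · exact (key t s ht.1 h ht.2 hs.2).elim
  filter_upwards [measure_eq_zero_iff_ae_notMem.1 (hsub.measure_zero volume)] with t ht ht0 h
  exact ht ⟨ht0, h⟩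

theorem tendsto_indicator_ball {E : Type*} [SeminormedAddCommGroup E] {r : ℝ} {x : E}
    (h : ‖x‖ ≠ r ∨ r = 0) :
    Tendsto (fun x' => (Metric.ball (0 : E) r).indicator (fun _ => (1 : ℝ≥0∞)) x') (𝓝 x)
      (𝓝 ((Metric.ball (0 : E) r).indicator (fun _ => (1 : ℝ≥0∞)) x)) := by
  rcases eq_or_ne r 0 with rfl | hr
  · simp
  rcases lt_or_gt_of_ne (h.resolve_right hr) with h | h
  · refine tendsto_const_nhds.congr' ?_
    filter_upwards [continuous_norm.continuousAt.eventually_lt_const h] with x' hx'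
    rw [Set.indicator_of_mem (by simpa using h), Set.indicator_of_mem (by simpa using hx')]
  · refine tendsto_const_nhds.congr' ?_
    filter_upwards [continuous_norm.continuousAt.eventually_const_lt h] with x' hx'
    rw [Set.indicator_of_notMem (by simpa using h.le),
      Set.indicator_of_notMem (by simpa using hx'.le)]

/-- **Symmetrization preserves continuity.** -/
theorem symmRearrange_continuous {d : ℕ} (hd : 1 ≤ d)
    (f : EuclideanSpace ℝ (Fin d) → ℝ) (hf_cont : Continuous f)
    (hf_nonneg : ∀ x, 0 ≤ f x) (hf_bdd : ∃ M : ℝ, ∀ x, f x ≤ M)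
    (hf_van : VanishesAtInfinity f) :
    Continuous (symmRearrange f) := by
  obtain ⟨M, hM⟩ := hf_bdd
  refine continuous_iff_continuousAt.2 fun x => ?_
  refine tendsto_lintegral_filter_of_dominated_convergence
    ((Set.Iio M).indicator fun _ => (1 : ℝ≥0∞)) ?_ ?_ ?_ ?_
  · refine Eventually.of_forall fun x' => ?_
    have hset : MeasurableSet {t : ℝ | x' ∈ ballStar {y | t < f y}} := by
      simp only [ballStar, mem_ball_zero_iff]
      exact measurableSet_lt measurable_const (measurable_symmRadius_superlevel f)
    exact measurable_const.indicator hset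
  · refine Eventually.of_forall fun x' => Eventually.of_forall fun t => ?_
    rcases lt_or_ge t M with h | h
    · rw [Set.indicator_of_mem (s := Set.Iio M) h]
      exact Set.indicator_le_self' (fun _ _ => zero_le) x'
    · have hempty : {y | t < f y} = ∅ :=
        Set.eq_empty_of_forall_notMem fun y hy => absurd ((hM y).trans h) (not_le.2 hy)
      have hr : symmRadius {y | t < f y} = 0 :=
        symmRadius_of_volume_eq_zero hd (by rw [hempty, measure_empty])
      simp [ballStar, hr]
  · rw [lintegral_indicator_const measurableSet_Iio, one_mul,
      Measure.restrict_apply measurableSet_Iio, Set.Iio_inter_Ioi, Real.volume_Ioo]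
    exact ENNReal.ofReal_ne_top
  · rcases eq_or_ne ‖x‖ 0 with hx | hx
    · refine Eventually.of_forall fun t => tendsto_indicator_ball ?_
      rw [hx]
      exact (ne_or_eq _ _).imp id Eq.symm
    · filter_upwards [ae_symmRadius_superlevel_ne hd hf_cont hf_van hx] with t ht
      exact tendsto_indicator_ball (Or.inl ht.symm)
end
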